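/- arXiv:1212.2285 — 6 statements merged into one kernel-verified Lean document; each statement's English description precedes it below -/
import Mathlib

section
/- Let g : ℝ³ → ℝ be a Schwartz function and k ≠ 0 a real number such that Δg(x) + 5 φ(x)⁴ g(x) = k² g(x) for all x ∈ ℝ³ (i.e., g is an eigenfunction of H = −Δ − 5φ⁴ with negative eigenvalue −k²). Then ∫_{ℝ³} ψ(x) g(x) dx = 0, where ψ(x) = (3^{1/4}/4)(1 − ‖x‖²)(1 + ‖x‖²)^{-3/2} is the zero resonance of H. -/
open MeasureTheory

/-- The soliton `φₐ(x) = (3a)^{1/4} (1 + a‖x‖²)^{-1/2}` on `ℝ³`. -/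
noncomputable def soliton (a : ℝ) (x : EuclideanSpace ℝ (Fin 3)) : ℝ :=
  (3 * a) ^ ((1 : ℝ) / 4) * (1 + a * ‖x‖ ^ 2) ^ (-(1 : ℝ) / 2)

/-- The Euclidean Laplacian `Δf(x) = ∑ᵢ ∂²f/∂xᵢ²` on `ℝ³`. -/
noncomputable def lap (f : EuclideanSpace ℝ (Fin 3) → ℝ) (x : EuclideanSpace ℝ (Fin 3)) : ℝ :=
  ∑ i : Fin 3,
    fderiv ℝ (fun y => fderiv ℝ f y (EuclideanSpace.single i 1)) x (EuclideanSpace.single i 1)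

/-- The zero resonance `ψ(x) = (3^{1/4}/4)(1 − ‖x‖²)(1 + ‖x‖²)^{-3/2}` of `H = -Δ - 5φ⁴`. -/
noncomputable def resonance (x : EuclideanSpace ℝ (Fin 3)) : ℝ :=
  ((3 : ℝ) ^ ((1 : ℝ) / 4) / 4) * (1 - ‖x‖ ^ 2) * (1 + ‖x‖ ^ 2) ^ (-(3 : ℝ) / 2)

namespace Function.HasTemperateGrowth

variable {E : Type*} [NormedAddCommGroup E] [NormedSpace ℝ E] {f : E → ℝ}

protected theorem fderiv (hf : f.HasTemperateGrowth) : (fderiv ℝ f).HasTemperateGrowth := by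
  refine ⟨hf.1.fderiv_right (by simp), fun n ↦ ?_⟩
  obtain ⟨k, C, h⟩ := hf.2 (n + 1)
  exact ⟨k, C, fun x ↦ by simpa only [norm_iteratedFDeriv_fderiv] using h x⟩

theorem fderiv_apply (hf : f.HasTemperateGrowth) (v : E) :
    (fun x ↦ fderiv ℝ f x v).HasTemperateGrowth :=
  (ContinuousLinearMap.apply ℝ ℝ v).hasTemperateGrowth.comp hf.fderiv

variable [MeasurableSpace E] [BorelSpace E] [FiniteDimensional ℝ E]
  (μ : Measure E) [μ.IsAddHaarMeasure]

theorem integrable_mul_schwartz (hf : f.HasTemperateGrowth) (g : SchwartzMap E ℝ) :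
    Integrable (fun x ↦ f x * g x) μ := by
  simpa [SchwartzMap.smulLeftCLM_apply hf] using (SchwartzMap.smulLeftCLM ℝ f g).integrable (μ := μ)

open LineDeriv in
theorem integral_mul_fderiv_schwartz (hf : f.HasTemperateGrowth) (g : SchwartzMap E ℝ) (v : E) :
    ∫ x, f x * fderiv ℝ g x v ∂μ = -∫ x, fderiv ℝ f x v * g x ∂μ :=
  integral_mul_fderiv_eq_neg_fderiv_mul_of_integrable
    ((hf.fderiv_apply v).integrable_mul_schwartz μ g)
    (hf.integrable_mul_schwartz μ (∂_{v} g : SchwartzMap E ℝ))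
    (hf.integrable_mul_schwartz μ g)
    (fun x _ ↦ (hf.1.differentiable (by simp)).differentiableAt)
    (fun x _ ↦ g.differentiableAt)

open LineDeriv in
theorem integral_mul_fderiv_fderiv_schwartz (hf : f.HasTemperateGrowth) (g : SchwartzMap E ℝ)
    (v : E) :
    ∫ x, f x * fderiv ℝ (fun y ↦ fderiv ℝ g y v) x v ∂μ =
      ∫ x, fderiv ℝ (fun y ↦ fderiv ℝ f y v) x v * g x ∂μ := by
  have h₁ := hf.integral_mul_fderiv_schwartz μ (∂_{v} g : SchwartzMap E ℝ) v
  have h₂ := (hf.fderiv_apply v).integral_mul_fderiv_schwartz μ g v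
  rw [← neg_neg (∫ x, fderiv ℝ (fun y ↦ fderiv ℝ f y v) x v * g x ∂μ), ← h₂]
  exact h₁

end Function.HasTemperateGrowth

/-- Green's second identity on `ℝ³`, for a function of temperate growth and a Schwartz function. -/
theorem integral_mul_lap_schwartz {f : EuclideanSpace ℝ (Fin 3) → ℝ} (hf : f.HasTemperateGrowth)
    (g : SchwartzMap (EuclideanSpace ℝ (Fin 3)) ℝ) :
    ∫ x, f x * lap g x = ∫ x, lap f x * g x := by
  simp only [lap, Finset.mul_sum, Finset.sum_mul]
  rw [integral_finsetSum, integral_finsetSum]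
  · exact Finset.sum_congr rfl fun i _ ↦ hf.integral_mul_fderiv_fderiv_schwartz volume g _
  · exact fun i _ ↦ ((hf.fderiv_apply _).fderiv_apply _).integrable_mul_schwartz volume g
  · intro i _
    exact hf.integrable_mul_schwartz volume (LineDeriv.lineDerivOp (EuclideanSpace.single i (1 : ℝ))
      (LineDeriv.lineDerivOp (EuclideanSpace.single i (1 : ℝ)) g))

theorem hasFDerivAt_one_add_norm_sq_rpow {E : Type*} [NormedAddCommGroup E] [InnerProductSpace ℝ E]
    (r : ℝ) (x : E) :
    HasFDerivAt (fun y : E ↦ (1 + ‖y‖ ^ 2) ^ r)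
      ((2 * r * (1 + ‖x‖ ^ 2) ^ (r - 1)) • innerSL ℝ x) x := by
  have h := ((hasStrictFDerivAt_norm_sq x).hasFDerivAt.const_add 1).rpow_const
    (p := r) (Or.inl (by positivity))
  convert h using 1
  ext v
  simp
  ring

theorem lap_one_add_norm_sq_rpow (r : ℝ) (x : EuclideanSpace ℝ (Fin 3)) :
    lap (fun y ↦ (1 + ‖y‖ ^ 2) ^ r) x =
      2 * r * (2 * r + 1) * (1 + ‖x‖ ^ 2) ^ (r - 1)
        - 4 * r * (r - 1) * (1 + ‖x‖ ^ 2) ^ (r - 2) := by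
  have h (i : Fin 3) : fderiv ℝ (fun y : EuclideanSpace ℝ (Fin 3) ↦
        fderiv ℝ (fun y ↦ (1 + ‖y‖ ^ 2) ^ r) y (EuclideanSpace.single i 1)) x
        (EuclideanSpace.single i 1) =
      2 * r * (1 + ‖x‖ ^ 2) ^ (r - 1) + 4 * r * (r - 1) * (1 + ‖x‖ ^ 2) ^ (r - 2) * x i ^ 2 := by
    have hi : (fun y : EuclideanSpace ℝ (Fin 3) ↦
        fderiv ℝ (fun y ↦ (1 + ‖y‖ ^ 2) ^ r) y (EuclideanSpace.single i 1)) =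
        fun y ↦ 2 * r * (1 + ‖y‖ ^ 2) ^ (r - 1) * EuclideanSpace.proj (𝕜 := ℝ) i y := by
      ext y
      rw [(hasFDerivAt_one_add_norm_sq_rpow r y).fderiv]
      simp [EuclideanSpace.inner_single_right]
    rw [hi, (((hasFDerivAt_one_add_norm_sq_rpow (r - 1) x).const_mul (2 * r)).fun_mul
      (EuclideanSpace.proj (𝕜 := ℝ) i).hasFDerivAt).fderiv]
    simp [EuclideanSpace.inner_single_right, show r - 1 - 1 = r - 2 by ring]
    ring
  have hx : x 0 ^ 2 + x 1 ^ 2 + x 2 ^ 2 = ‖x‖ ^ 2 := by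
    simp [EuclideanSpace.norm_sq_eq, Fin.sum_univ_three]
  have hs : (1 + ‖x‖ ^ 2) ^ (r - 1) = (1 + ‖x‖ ^ 2) ^ (r - 2) * (1 + ‖x‖ ^ 2) := by
    rw [← Real.rpow_add_one (by positivity)]
    ring_nf
  simp only [lap, h, Fin.sum_univ_three]
  linear_combination 4 * r * (r - 1) * (1 + ‖x‖ ^ 2) ^ (r - 2) * hx - 4 * r * (r - 1) * hs

theorem resonance_eq (x : EuclideanSpace ℝ (Fin 3)) :
    resonance x = (3 : ℝ) ^ ((1 : ℝ) / 4) / 4 *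
      (2 * (1 + ‖x‖ ^ 2) ^ (-(3 : ℝ) / 2) - (1 + ‖x‖ ^ 2) ^ (-(1 : ℝ) / 2)) := by
  have h : (1 + ‖x‖ ^ 2) ^ (-(1 : ℝ) / 2) = (1 + ‖x‖ ^ 2) ^ (-(3 : ℝ) / 2) * (1 + ‖x‖ ^ 2) := by
    rw [← Real.rpow_add_one (by positivity)]
    norm_num
  rw [resonance, h]
  ring

theorem hasTemperateGrowth_resonance : resonance.HasTemperateGrowth := by
  rw [funext resonance_eq]
  fun_prop

theorem soliton_one_pow_four (x : EuclideanSpace ℝ (Fin 3)) :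
    soliton 1 x ^ 4 = 3 * (1 + ‖x‖ ^ 2) ^ (-2 : ℝ) := by
  have h₃ : ((3 : ℝ) ^ ((1 : ℝ) / 4)) ^ 4 = 3 := by
    rw [← Real.rpow_mul_natCast (by norm_num)]
    norm_num
  have hs : ((1 + ‖x‖ ^ 2) ^ (-(1 : ℝ) / 2)) ^ 4 = (1 + ‖x‖ ^ 2) ^ (-2 : ℝ) := by
    rw [← Real.rpow_mul_natCast (by positivity)]
    norm_num
  rw [soliton, mul_one, one_mul, mul_pow, h₃, hs]

theorem lap_linear_comb {f g : EuclideanSpace ℝ (Fin 3) → ℝ} (hf : ContDiff ℝ 2 f)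
    (hg : ContDiff ℝ 2 g) (a b : ℝ) (x : EuclideanSpace ℝ (Fin 3)) :
    lap (fun y ↦ a * f y + b * g y) x = a * lap f x + b * lap g x := by
  have hd {u : EuclideanSpace ℝ (Fin 3) → ℝ} (hu : ContDiff ℝ 2 u) (v : EuclideanSpace ℝ (Fin 3)) :
      Differentiable ℝ fun y ↦ fderiv ℝ u y v :=
    ((hu.fderiv_right (m := 1) (by norm_num)).clm_apply contDiff_const).differentiable (by simp)
  have key (u w : EuclideanSpace ℝ (Fin 3) → ℝ) (hu : Differentiable ℝ u)
      (hw : Differentiable ℝ w) (y v : EuclideanSpace ℝ (Fin 3)) :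
      fderiv ℝ (fun z ↦ a * u z + b * w z) y v = a * fderiv ℝ u y v + b * fderiv ℝ w y v := by
    rw [(((hu y).hasFDerivAt.const_mul a).fun_add ((hw y).hasFDerivAt.const_mul b)).fderiv]
    simp
  simp only [lap, Finset.mul_sum, ← Finset.sum_add_distrib]
  refine Finset.sum_congr rfl fun i _ ↦ ?_
  simp_rw [key f g (hf.differentiable (by simp)) (hg.differentiable (by simp))]
  exact key _ _ (hd hf _) (hd hg _) _ _

/-- The resonance equation `Δψ + 5φ⁴ψ = 0`. -/
theorem lap_resonance (x : EuclideanSpace ℝ (Fin 3)) :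
    lap resonance x = -(5 * soliton 1 x ^ 4 * resonance x) := by
  have hC (r : ℝ) : ContDiff ℝ 2 fun y : EuclideanSpace ℝ (Fin 3) ↦ (1 + ‖y‖ ^ 2) ^ r :=
    contDiff_infty.1 (Function.hasTemperateGrowth_one_add_norm_sq_rpow _ r).1 2
  have hψ : resonance = fun y ↦
      ((3 : ℝ) ^ ((1 : ℝ) / 4) / 2) * (1 + ‖y‖ ^ 2) ^ (-(3 : ℝ) / 2) +
        (-((3 : ℝ) ^ ((1 : ℝ) / 4) / 4)) * (1 + ‖y‖ ^ 2) ^ (-(1 : ℝ) / 2) := by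
    funext y
    rw [resonance_eq]
    ring
  rw [soliton_one_pow_four, resonance, hψ, lap_linear_comb (hC _) (hC _),
    lap_one_add_norm_sq_rpow, lap_one_add_norm_sq_rpow]
  have h₅ : (1 + ‖x‖ ^ 2) ^ (-(5 : ℝ) / 2) = (1 + ‖x‖ ^ 2) ^ (-(7 : ℝ) / 2) * (1 + ‖x‖ ^ 2) := by
    rw [← Real.rpow_add_one (by positivity)]
    norm_num
  have h₇ : (1 + ‖x‖ ^ 2) ^ (-(7 : ℝ) / 2) =
      (1 + ‖x‖ ^ 2) ^ (-2 : ℝ) * (1 + ‖x‖ ^ 2) ^ (-(3 : ℝ) / 2) := by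
    rw [← Real.rpow_add (by positivity)]
    norm_num
  rw [show -(3 : ℝ) / 2 - 1 = -5 / 2 by norm_num, show -(3 : ℝ) / 2 - 2 = -7 / 2 by norm_num,
    show -(1 : ℝ) / 2 - 1 = -3 / 2 by norm_num, show -(1 : ℝ) / 2 - 2 = -5 / 2 by norm_num,
    h₅, h₇]
  ring

/-- If `g` is a Schwartz eigenfunction of `H = -Δ - 5φ⁴` with negative eigenvalue `-k²`
(`k ≠ 0`), i.e. `Δg + 5φ⁴g = k²g`, then `g` is orthogonal to the zero resonance `ψ`:
`∫ ψ g = 0` (i.e. `⟨∂ₐφ, g⟩ = 0`). -/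
theorem stmt_5 (g : SchwartzMap (EuclideanSpace ℝ (Fin 3)) ℝ) (k : ℝ) (hk : k ≠ 0)
    (heig : ∀ x : EuclideanSpace ℝ (Fin 3),
      lap (⇑g) x + 5 * (soliton 1 x) ^ 4 * g x = k ^ 2 * g x) :
    ∫ x : EuclideanSpace ℝ (Fin 3), resonance x * g x = 0 := by
  have hφ : (fun x ↦ 5 * soliton 1 x ^ 4 * resonance x).HasTemperateGrowth := by
    simp_rw [soliton_one_pow_four]
    have := hasTemperateGrowth_resonance
    fun_prop
  have hint := hφ.integrable_mul_schwartz volume g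
  have hlap : ∀ x, resonance x * lap g x =
      k ^ 2 * (resonance x * g x) - 5 * soliton 1 x ^ 4 * resonance x * g x := fun x ↦ by
    linear_combination resonance x * heig x
  have green := integral_mul_lap_schwartz hasTemperateGrowth_resonance g
  simp_rw [hlap, lap_resonance, neg_mul] at green
  rw [integral_sub ((hasTemperateGrowth_resonance.integrable_mul_schwartz volume g).const_mul _)
    hint, integral_neg, integral_const_mul] at green
  have : k ^ 2 * ∫ x, resonance x * g x = 0 := by linarith
  exact (mul_eq_zero.mp this).resolve_left (pow_ne_zero 2 hk)
end

section
/- For every measurable function f : ℝ³ → ℝ and every x ∈ ℝ³ one has ∫₀^∞ ( r ∫_{S²} |f(x + rω)| dσ(ω) )² dr ≤ 4π ∫_{ℝ³} f(y)² dy, where both sides may be infinite. (This is the kernel form of the reverse Strichartz estimate ‖ sin(t√(−Δ))/√(−Δ) f ‖_{L^∞_x L²_t} ≲ ‖f‖_{L²} for the free wave evolution, whose kernel at time r is the normalized surface measure (1/(4πr)) on the sphere of radius r.) -/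
open MeasureTheory
open scoped ENNReal

/-- Cauchy–Schwarz against the constant function `1`. -/
theorem lintegral_sq_le_measure_univ_mul {α : Type*} [MeasurableSpace α] (μ : Measure α)
    {g : α → ℝ≥0∞} (hg : AEMeasurable g μ) :
    (∫⁻ a, g a ∂μ) ^ 2 ≤ μ Set.univ * ∫⁻ a, g a ^ 2 ∂μ := by
  have h := ENNReal.lintegral_mul_le_Lp_mul_Lq μ Real.HolderConjugate.two_two
    (aemeasurable_const (b := (1 : ℝ≥0∞))) hg
  simp only [Pi.mul_apply, one_mul, ENNReal.rpow_two, one_pow, lintegral_one] at h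
  calc (∫⁻ a, g a ∂μ) ^ 2
      ≤ (μ Set.univ ^ (1 / 2 : ℝ) * (∫⁻ a, g a ^ 2 ∂μ) ^ (1 / 2 : ℝ)) ^ 2 := by gcongr
    _ = μ Set.univ * ∫⁻ a, g a ^ 2 ∂μ := by
      rw [mul_pow, ← ENNReal.rpow_mul_natCast, ← ENNReal.rpow_mul_natCast]
      norm_num

/-- Kernel form of the reverse Strichartz estimate
`‖ sin(t√(−Δ))/√(−Δ) f ‖_{L^∞_x L²_t} ≲ ‖f‖_{L²}` for the free wave evolution in `ℝ³`:
if `σ` is the surface measure on the unit sphere `S²` (characterized by `σ(S²) = 4π` and the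
polar coordinates formula), then for every measurable `f` and every `x`,
`∫₀^∞ ( r ∫_{S²} |f(x + rω)| dσ(ω) )² dr ≤ 4π ∫ f²`, where both sides may be infinite. -/
theorem stmt_7
    (σ : Measure (Metric.sphere (0 : EuclideanSpace ℝ (Fin 3)) 1))
    (hσ : σ Set.univ = ENNReal.ofReal (4 * Real.pi))
    (hpolar : ∀ h : EuclideanSpace ℝ (Fin 3) → ℝ≥0∞, Measurable h →
      ∀ x : EuclideanSpace ℝ (Fin 3),
        ∫⁻ y, h y = ∫⁻ r in Set.Ioi (0 : ℝ),
          (∫⁻ ω, h (x + r • (ω : EuclideanSpace ℝ (Fin 3))) ∂σ) * ENNReal.ofReal (r ^ 2))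
    (f : EuclideanSpace ℝ (Fin 3) → ℝ) (hf : Measurable f)
    (x : EuclideanSpace ℝ (Fin 3)) :
    ∫⁻ r in Set.Ioi (0 : ℝ),
        (ENNReal.ofReal r *
          ∫⁻ ω, ENNReal.ofReal |f (x + r • (ω : EuclideanSpace ℝ (Fin 3)))| ∂σ) ^ 2
      ≤ ENNReal.ofReal (4 * Real.pi) * ∫⁻ y, ENNReal.ofReal (f y ^ 2) := by
  rw [hpolar _ (hf.pow_const 2).ennreal_ofReal x, ← lintegral_const_mul' _ _ ENNReal.ofReal_ne_top]
  refine setLIntegral_mono' measurableSet_Ioi fun r hr => ?_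
  have hg : Measurable fun ω : Metric.sphere (0 : EuclideanSpace ℝ (Fin 3)) 1 =>
      ENNReal.ofReal |f (x + r • (ω : EuclideanSpace ℝ (Fin 3)))| :=
    (hf.comp (by fun_prop)).abs.ennreal_ofReal
  have h := lintegral_sq_le_measure_univ_mul σ hg.aemeasurable
  simp only [hσ, ← ENNReal.ofReal_pow (abs_nonneg _), sq_abs] at h
  rw [mul_pow, ← ENNReal.ofReal_pow (le_of_lt hr), mul_comm, ← mul_assoc]
  gcongr
end

section
/- Let f : ℝ³ → ℝ be a Schwartz function and define u : ℝ³ × ℝ → ℝ by u(x, t) = (t / 4π) ∫_{S²} f(x + tω) dσ(ω). Then u is smooth, satisfies the wave equation ∂ₜ² u(x, t) = Δₓ u(x, t) for all (x, t) ∈ ℝ³ × ℝ, and has initial data u(x, 0) = 0 and ∂ₜ u(x, 0) = f(x) for all x ∈ ℝ³. (Kirchhoff's formula: u(x,t) = sin(t√(−Δ))/√(−Δ) f (x) is given by (1/(4πt)) ∫_{‖x−y‖=t} f(y) dS(y).) -/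
open MeasureTheory
open scoped ENNReal

section ParametricIntegral

variable {X : Type*} [TopologicalSpace X] [CompactSpace X]
  [MeasurableSpace X] [OpensMeasurableSpace X] {μ : Measure X} [IsFiniteMeasure μ]

theorem Continuous.integrable_of_compactSpace {F : Type*} [NormedAddCommGroup F]
    {h : X → F} (hh : Continuous h) : Integrable h μ :=
  hh.integrable_of_hasCompactSupport (HasCompactSupport.of_compactSpace h)

theorem continuous_integral_of_compactSpace [SecondCountableTopology X]
    {P F : Type*} [TopologicalSpace P]
    [FirstCountableTopology P] [LocallyCompactSpace P] [NormedAddCommGroup F] [NormedSpace ℝ F]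
    {h : P → X → F} (hc : Continuous fun p : P × X => h p.1 p.2) :
    Continuous fun p => ∫ x, h p x ∂μ := by
  have := continuous_parametric_integral_of_continuous (μ := μ) (f := h) hc isCompact_univ
  simpa using this

theorem hasFDerivAt_integral_of_compactSpace {P F : Type*} [NormedAddCommGroup P]
    [NormedSpace ℝ P] [FiniteDimensional ℝ P] [NormedAddCommGroup F] [NormedSpace ℝ F]
    {h : P → X → F} {h' : P → X → P →L[ℝ] F}
    (hc : ∀ p, Continuous (h p)) (hc' : Continuous fun p : P × X => h' p.1 p.2)
    (hd : ∀ p x, HasFDerivAt (fun q => h q x) (h' p x) p) (p : P) :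
    HasFDerivAt (fun q => ∫ x, h q x ∂μ) (∫ x, h' p x ∂μ) p := by
  have : ProperSpace P := FiniteDimensional.proper ℝ P
  obtain ⟨C, hC⟩ := ((isCompact_closedBall p 1).prod
    (isCompact_univ (X := X))).exists_bound_of_continuousOn hc'.continuousOn
  refine hasFDerivAt_integral_of_dominated_of_fderiv_le (bound := fun _ => C)
    (Metric.closedBall_mem_nhds p one_pos)
    (Filter.Eventually.of_forall fun q => (hc q).integrable_of_compactSpace.aestronglyMeasurable)
    (hc p).integrable_of_compactSpace
    (hc'.comp (by fun_prop : Continuous fun x : X =>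
      (p, x))).integrable_of_compactSpace.aestronglyMeasurable
    (Filter.Eventually.of_forall fun x q hq => hC (q, x) ⟨hq, Set.mem_univ x⟩)
    (integrable_const C)
    (Filter.Eventually.of_forall fun x q _ => hd q x)

theorem hasDerivAt_integral_of_compactSpace {F : Type*} [NormedAddCommGroup F] [NormedSpace ℝ F]
    {h h' : ℝ → X → F}
    (hc : ∀ t, Continuous (h t)) (hc' : Continuous fun p : ℝ × X => h' p.1 p.2)
    (hd : ∀ t x, HasDerivAt (fun s => h s x) (h' t x) t) (t : ℝ) :
    HasDerivAt (fun s => ∫ x, h s x ∂μ) (∫ x, h' t x ∂μ) t := by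
  obtain ⟨C, hC⟩ := ((isCompact_closedBall t 1).prod
    (isCompact_univ (X := X))).exists_bound_of_continuousOn hc'.continuousOn
  exact (hasDerivAt_integral_of_dominated_loc_of_deriv_le (bound := fun _ => C)
    (Metric.closedBall_mem_nhds t one_pos)
    (Filter.Eventually.of_forall fun q => (hc q).integrable_of_compactSpace.aestronglyMeasurable)
    (hc t).integrable_of_compactSpace
    (hc'.comp (by fun_prop : Continuous fun x : X =>
      (t, x))).integrable_of_compactSpace.aestronglyMeasurable
    (Filter.Eventually.of_forall fun x q hq => hC (q, x) ⟨hq, Set.mem_univ x⟩)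
    (integrable_const C)
    (Filter.Eventually.of_forall fun x q _ => hd q x)).2

theorem contDiff_nat_integral_of_compactSpace [SecondCountableTopology X]
    {P V F : Type*} [NormedAddCommGroup P]
    [NormedSpace ℝ P] [FiniteDimensional ℝ P] [NormedAddCommGroup V] [NormedSpace ℝ V]
    [NormedAddCommGroup F] [NormedSpace ℝ F]
    {ι : X → V} (hι : Continuous ι) (n : ℕ) :
    ∀ {g : P × V → F}, ContDiff ℝ n g → ContDiff ℝ n fun p => ∫ x, g (p, ι x) ∂μ := by
  have : ProperSpace P := FiniteDimensional.proper ℝ P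
  induction n with
  | zero =>
    intro g hg
    rw [Nat.cast_zero, contDiff_zero] at hg ⊢
    exact continuous_integral_of_compactSpace (h := fun p x => g (p, ι x)) (by fun_prop)
  | succ n ih =>
    intro g hg
    rw [Nat.cast_succ] at hg ⊢
    have hg1 : ContDiff ℝ 1 g := hg.of_le (by simp)
    have hg' : Continuous (fderiv ℝ g) := hg1.continuous_fderiv one_ne_zero
    have hcL : Continuous fun p : P × X =>
        (fderiv ℝ g (p.1, ι p.2)).comp (ContinuousLinearMap.inl ℝ P V) := by fun_prop
    have hD : ∀ p, HasFDerivAt (fun p => ∫ x, g (p, ι x) ∂μ)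
        (∫ x, (fderiv ℝ g (p, ι x)).comp (ContinuousLinearMap.inl ℝ P V) ∂μ) p := by
      refine hasFDerivAt_integral_of_compactSpace
        (fun p => hg.continuous.comp (by fun_prop : Continuous fun x => (p, ι x))) hcL fun p x => ?_
      exact ((hg1.differentiable one_ne_zero).differentiableAt.hasFDerivAt).comp p
        (hasFDerivAt_prodMk_left p (ι x))
    rw [contDiff_succ_iff_fderiv_apply]
    refine ⟨fun p => (hD p).differentiableAt, fun h => by simp at h, fun y => ?_⟩
    have key := ih (g := fun q => fderiv ℝ g q (y, 0))
      ((hg.fderiv_right le_rfl).clm_apply contDiff_const)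
    convert key using 2 with p
    rw [(hD p).fderiv, ContinuousLinearMap.integral_apply]
    · simp
    · exact (hcL.comp (by fun_prop : Continuous fun x : X => (p, x))).integrable_of_compactSpace

theorem contDiff_integral_of_compactSpace [SecondCountableTopology X]
    {P V F : Type*} [NormedAddCommGroup P]
    [NormedSpace ℝ P] [FiniteDimensional ℝ P] [NormedAddCommGroup V] [NormedSpace ℝ V]
    [NormedAddCommGroup F] [NormedSpace ℝ F]
    {ι : X → V} (hι : Continuous ι) {g : P × V → F} (hg : ContDiff ℝ (⊤ : ℕ∞) g) :
    ContDiff ℝ (⊤ : ℕ∞) fun p => ∫ x, g (p, ι x) ∂μ :=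
  contDiff_infty.2 fun n => contDiff_nat_integral_of_compactSpace hι n (contDiff_infty.1 hg n)

end ParametricIntegral

theorem map_smul_sphere_prod_eq_volume
    (σ : Measure (Metric.sphere (0 : EuclideanSpace ℝ (Fin 3)) 1)) [IsFiniteMeasure σ]
    (hpolar : ∀ h : EuclideanSpace ℝ (Fin 3) → ℝ≥0∞, Measurable h →
      ∫⁻ y, h y = ∫⁻ r in Set.Ioi (0 : ℝ),
        (∫⁻ ω, h (r • (ω : EuclideanSpace ℝ (Fin 3))) ∂σ) * ENNReal.ofReal (r ^ 2)) :
    ((((volume.restrict (Set.Ioi (0 : ℝ))).withDensity fun r => ENNReal.ofReal (r ^ 2)).prod σ).map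
      fun p => p.1 • (p.2 : EuclideanSpace ℝ (Fin 3))) = volume := by
  have hm : Measurable fun p : ℝ × Metric.sphere (0 : EuclideanSpace ℝ (Fin 3)) 1 =>
      p.1 • (p.2 : EuclideanSpace ℝ (Fin 3)) :=
    (by fun_prop : Continuous fun p : ℝ × Metric.sphere (0 : EuclideanSpace ℝ (Fin 3)) 1 =>
      p.1 • (p.2 : EuclideanSpace ℝ (Fin 3))).measurable
  have hd : Measurable fun r : ℝ => ENNReal.ofReal (r ^ 2) := by fun_prop
  ext s hs
  have hi : Measurable (s.indicator (1 : EuclideanSpace ℝ (Fin 3) → ℝ≥0∞)) :=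
    measurable_one.indicator hs
  rw [← lintegral_indicator_one hs, ← lintegral_indicator_one hs, lintegral_map hi hm,
    lintegral_prod (fun p : ℝ × Metric.sphere (0 : EuclideanSpace ℝ (Fin 3)) 1 =>
      s.indicator 1 (p.1 • (p.2 : EuclideanSpace ℝ (Fin 3)))) (hi.comp hm).aemeasurable,
    lintegral_withDensity_eq_lintegral_mul _ hd
      (g := fun r => ∫⁻ ω, s.indicator 1 (r • (ω : EuclideanSpace ℝ (Fin 3))) ∂σ)
      (hi.comp hm).lintegral_prod_right', hpolar _ hi]
  simp only [Pi.mul_apply, mul_comm]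

theorem integral_eq_integral_sphere
    (σ : Measure (Metric.sphere (0 : EuclideanSpace ℝ (Fin 3)) 1)) [IsFiniteMeasure σ]
    (hpolar : ∀ h : EuclideanSpace ℝ (Fin 3) → ℝ≥0∞, Measurable h →
      ∫⁻ y, h y = ∫⁻ r in Set.Ioi (0 : ℝ),
        (∫⁻ ω, h (r • (ω : EuclideanSpace ℝ (Fin 3))) ∂σ) * ENNReal.ofReal (r ^ 2))
    {h : EuclideanSpace ℝ (Fin 3) → ℝ} (hh : Integrable h) :
    ∫ y, h y = ∫ r in Set.Ioi (0 : ℝ),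
      r ^ 2 * ∫ ω, h (r • (ω : EuclideanSpace ℝ (Fin 3))) ∂σ := by
  have hm : Measurable fun p : ℝ × Metric.sphere (0 : EuclideanSpace ℝ (Fin 3)) 1 =>
      p.1 • (p.2 : EuclideanSpace ℝ (Fin 3)) :=
    (by fun_prop : Continuous fun p : ℝ × Metric.sphere (0 : EuclideanSpace ℝ (Fin 3)) 1 =>
      p.1 • (p.2 : EuclideanSpace ℝ (Fin 3))).measurable
  have hmap := map_smul_sphere_prod_eq_volume σ hpolar
  have hd : Measurable fun r : ℝ => ENNReal.ofReal (r ^ 2) := by fun_prop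
  rw [← hmap] at hh
  rw [← hmap, integral_map hm.aemeasurable hh.aestronglyMeasurable,
    integral_prod (fun p : ℝ × Metric.sphere (0 : EuclideanSpace ℝ (Fin 3)) 1 =>
      h (p.1 • (p.2 : EuclideanSpace ℝ (Fin 3))))
      ((integrable_map_measure hh.aestronglyMeasurable hm.aemeasurable).1 hh),
    integral_withDensity_eq_integral_toReal_smul hd (by simp)]
  simp only [smul_eq_mul, ENNReal.toReal_ofReal (sq_nonneg _)]

/-- A test function `ψ` supported in `(0, ∞)` gives a smooth radial function `y ↦ ψ(‖y‖)`. -/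
theorem contDiff_comp_norm {ψ : ℝ → ℝ} (hψ : ContDiff ℝ (⊤ : ℕ∞) ψ)
    (hs : tsupport ψ ⊆ Set.Ioi 0) :
    ContDiff ℝ (⊤ : ℕ∞) fun y : EuclideanSpace ℝ (Fin 3) => ψ ‖y‖ := by
  rw [contDiff_iff_contDiffAt]
  intro y
  by_cases hy : y = 0
  · have h0 : ψ =ᶠ[nhds ‖y‖] 0 := by
      rw [← notMem_tsupport_iff_eventuallyEq]
      exact fun h => by simpa [hy] using hs h
    exact (contDiffAt_const (c := (0 : ℝ))).congr_of_eventuallyEq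
      (continuous_norm.continuousAt.eventually h0)
  · exact hψ.contDiffAt.comp y (contDiffAt_norm ℝ hy)

theorem hasCompactSupport_comp_norm {ψ : ℝ → ℝ} (hc : HasCompactSupport ψ) :
    HasCompactSupport fun y : EuclideanSpace ℝ (Fin 3) => ψ ‖y‖ := by
  obtain ⟨R, hR⟩ := hc.isCompact.isBounded.subset_closedBall 0
  refine HasCompactSupport.intro (isCompact_closedBall 0 R) fun y hy => ?_
  by_contra h
  have := hR (subset_tsupport ψ h)
  simp at this hy
  linarith

theorem fderiv_comp_norm_smul_sphere {ψ : ℝ → ℝ} (hψ : Differentiable ℝ ψ) {r : ℝ} (hr : 0 < r)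
    (ω : Metric.sphere (0 : EuclideanSpace ℝ (Fin 3)) 1) (v : EuclideanSpace ℝ (Fin 3)) :
    fderiv ℝ (fun y : EuclideanSpace ℝ (Fin 3) => ψ ‖y‖) (r • (ω : EuclideanSpace ℝ (Fin 3))) v =
      deriv ψ r * inner ℝ (ω : EuclideanSpace ℝ (Fin 3)) v := by
  have hω : ‖(ω : EuclideanSpace ℝ (Fin 3))‖ = 1 := by simp
  have hn : ‖r • (ω : EuclideanSpace ℝ (Fin 3))‖ = r := by
    rw [norm_smul, hω, mul_one, Real.norm_of_nonneg hr.le]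
  have h1 : HasFDerivAt (fun y : EuclideanSpace ℝ (Fin 3) => √(‖y‖ ^ 2)) _
      (r • (ω : EuclideanSpace ℝ (Fin 3))) :=
    ((hasStrictFDerivAt_norm_sq _).hasFDerivAt).sqrt (by rw [hn]; positivity)
  simp only [Real.sqrt_sq (norm_nonneg _)] at h1
  have h2 := (hψ ‖r • (ω : EuclideanSpace ℝ (Fin 3))‖).hasDerivAt.comp_hasFDerivAt _ h1
  have h3 := h2.fderiv
  simp only [Function.comp_def] at h3
  rw [h3, hn]
  simp
  field_simp
  simp

theorem sum_inner_mul_clm (L : EuclideanSpace ℝ (Fin 3) →L[ℝ] ℝ) (v : EuclideanSpace ℝ (Fin 3)) :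
    ∑ i : Fin 3, inner ℝ v (EuclideanSpace.single i (1 : ℝ)) * L (EuclideanSpace.single i 1) =
      L v := by
  conv_rhs => rw [← (EuclideanSpace.basisFun (Fin 3) ℝ).sum_repr v]
  simp [EuclideanSpace.inner_single_right]

/-- First Green identity for a compactly supported `χ`. -/
theorem integral_mul_lap_eq_neg {χ F : EuclideanSpace ℝ (Fin 3) → ℝ}
    (hχ : ContDiff ℝ (⊤ : ℕ∞) χ) (hc : HasCompactSupport χ) (hF : ContDiff ℝ (⊤ : ℕ∞) F) :
    ∫ y, χ y * lap F y = -∫ y, ∑ i : Fin 3, fderiv ℝ χ y (EuclideanSpace.single i 1) *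
      fderiv ℝ F y (EuclideanSpace.single i 1) := by
  have hχ' : Continuous (fderiv ℝ χ) := hχ.continuous_fderiv (by simp)
  have hF1 (v : EuclideanSpace ℝ (Fin 3)) : ContDiff ℝ (⊤ : ℕ∞) fun y => fderiv ℝ F y v :=
    (hF.fderiv_right (m := (⊤ : ℕ∞)) (by simp)).clm_apply contDiff_const
  have hF2 (v w : EuclideanSpace ℝ (Fin 3)) :
      Continuous fun y => fderiv ℝ (fun z => fderiv ℝ F z v) y w :=
    ((hF1 v).continuous_fderiv (by simp)).clm_apply continuous_const
  have i1 (v : EuclideanSpace ℝ (Fin 3)) : Integrable fun y => fderiv ℝ χ y v * fderiv ℝ F y v :=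
    ((hχ'.clm_apply continuous_const).mul (hF1 v).continuous).integrable_of_hasCompactSupport
      (hc.fderiv_apply ℝ v).mul_right
  have i2 (v : EuclideanSpace ℝ (Fin 3)) :
      Integrable fun y => χ y * fderiv ℝ (fun z => fderiv ℝ F z v) y v :=
    (hχ.continuous.mul (hF2 v v)).integrable_of_hasCompactSupport hc.mul_right
  have i3 (v : EuclideanSpace ℝ (Fin 3)) : Integrable fun y => χ y * fderiv ℝ F y v :=
    (hχ.continuous.mul (hF1 v).continuous).integrable_of_hasCompactSupport hc.mul_right
  simp only [lap, Finset.mul_sum]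
  rw [integral_finsetSum _ fun i _ => i2 _, integral_finsetSum _ fun i _ => i1 _,
    ← Finset.sum_neg_distrib]
  refine Finset.sum_congr rfl fun i _ => ?_
  exact integral_mul_fderiv_eq_neg_fderiv_mul_of_integrable (i1 _) (i2 _) (i3 _)
    (fun x _ => (hχ.differentiable (by simp)).differentiableAt)
    (fun x _ => ((hF1 _).differentiable (by simp)).differentiableAt)

theorem continuous_lap {F : EuclideanSpace ℝ (Fin 3) → ℝ} (hF : ContDiff ℝ (⊤ : ℕ∞) F) :
    Continuous (lap F) := by
  have hF1 (v : EuclideanSpace ℝ (Fin 3)) : ContDiff ℝ (⊤ : ℕ∞) fun y => fderiv ℝ F y v :=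
    (hF.fderiv_right (m := (⊤ : ℕ∞)) (by simp)).clm_apply contDiff_const
  exact continuous_finsetSum _ fun i _ =>
    ((hF1 _).continuous_fderiv (by simp)).clm_apply continuous_const

theorem hasDerivAt_fderiv_line {F : EuclideanSpace ℝ (Fin 3) → ℝ} (hF : ContDiff ℝ (⊤ : ℕ∞) F)
    (x w : EuclideanSpace ℝ (Fin 3)) (t : ℝ) :
    HasDerivAt (fun s : ℝ => fderiv ℝ F (x + s • w) w)
      (fderiv ℝ (fderiv ℝ F) (x + t • w) w w) t := by
  have h1 : HasFDerivAt (fderiv ℝ F) (fderiv ℝ (fderiv ℝ F) (x + t • w)) (x + t • w) :=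
    (((hF.fderiv_right (m := (⊤ : ℕ∞)) (by simp)).differentiable
      (by simp)).differentiableAt).hasFDerivAt
  have h2 : HasDerivAt (fun s : ℝ => x + s • w) w t := by
    simpa using ((hasDerivAt_id t).smul_const w).const_add x
  exact (ContinuousLinearMap.apply ℝ ℝ w).hasFDerivAt.comp_hasDerivAt t (h1.comp_hasDerivAt t h2)

/-- The Laplacian of `F` at unit radius in polar coordinates, averaged over the sphere. -/
theorem integral_sphere_lap
    (σ : Measure (Metric.sphere (0 : EuclideanSpace ℝ (Fin 3)) 1)) [IsFiniteMeasure σ]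
    (hpolar : ∀ h : EuclideanSpace ℝ (Fin 3) → ℝ≥0∞, Measurable h →
      ∫⁻ y, h y = ∫⁻ r in Set.Ioi (0 : ℝ),
        (∫⁻ ω, h (r • (ω : EuclideanSpace ℝ (Fin 3))) ∂σ) * ENNReal.ofReal (r ^ 2))
    {F : EuclideanSpace ℝ (Fin 3) → ℝ} (hF : ContDiff ℝ (⊤ : ℕ∞) F) :
    ∫ ω, fderiv ℝ (fderiv ℝ F) (ω : EuclideanSpace ℝ (Fin 3)) ω ω ∂σ +
      2 * ∫ ω, fderiv ℝ F (ω : EuclideanSpace ℝ (Fin 3)) ω ∂σ =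
      ∫ ω, lap F (ω : EuclideanSpace ℝ (Fin 3)) ∂σ := by
  have hF' : ContDiff ℝ (⊤ : ℕ∞) (fderiv ℝ F) := hF.fderiv_right (by simp)
  have hF1 : Continuous (fderiv ℝ F) := hF'.continuous
  have hF2 : Continuous (fderiv ℝ (fderiv ℝ F)) := hF'.continuous_fderiv (by simp)
  have hFl := continuous_lap hF
  set A : ℝ → ℝ := fun r => ∫ ω, fderiv ℝ F (r • (ω : EuclideanSpace ℝ (Fin 3))) ω ∂σ with hA
  set A' : ℝ → ℝ := fun r =>
    ∫ ω, fderiv ℝ (fderiv ℝ F) (r • (ω : EuclideanSpace ℝ (Fin 3))) ω ω ∂σ with hA'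
  set L : ℝ → ℝ := fun r => ∫ ω, lap F (r • (ω : EuclideanSpace ℝ (Fin 3))) ∂σ with hL
  have hAc : Continuous A := continuous_integral_of_compactSpace (μ := σ)
    (h := fun (r : ℝ) (ω : Metric.sphere (0 : EuclideanSpace ℝ (Fin 3)) 1) =>
      fderiv ℝ F (r • (ω : EuclideanSpace ℝ (Fin 3))) ω) (by fun_prop)
  have hc2 : Continuous fun p : ℝ × Metric.sphere (0 : EuclideanSpace ℝ (Fin 3)) 1 =>
      fderiv ℝ (fderiv ℝ F) (p.1 • (p.2 : EuclideanSpace ℝ (Fin 3))) p.2 p.2 := by fun_prop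
  have hA'c : Continuous A' := continuous_integral_of_compactSpace (μ := σ)
    (h := fun (r : ℝ) (ω : Metric.sphere (0 : EuclideanSpace ℝ (Fin 3)) 1) =>
      fderiv ℝ (fderiv ℝ F) (r • (ω : EuclideanSpace ℝ (Fin 3))) ω ω) hc2
  have hLc : Continuous L := continuous_integral_of_compactSpace (μ := σ)
    (h := fun (r : ℝ) (ω : Metric.sphere (0 : EuclideanSpace ℝ (Fin 3)) 1) =>
      lap F (r • (ω : EuclideanSpace ℝ (Fin 3)))) (by fun_prop)
  have hAd (r : ℝ) : HasDerivAt A (A' r) r := by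
    refine hasDerivAt_integral_of_compactSpace (μ := σ)
      (h := fun (r : ℝ) (ω : Metric.sphere (0 : EuclideanSpace ℝ (Fin 3)) 1) =>
        fderiv ℝ F (r • (ω : EuclideanSpace ℝ (Fin 3))) ω)
      (h' := fun (r : ℝ) (ω : Metric.sphere (0 : EuclideanSpace ℝ (Fin 3)) 1) =>
        fderiv ℝ (fderiv ℝ F) (r • (ω : EuclideanSpace ℝ (Fin 3))) ω ω)
      (fun t => by fun_prop) hc2 (fun t ω => ?_) r
    simpa using hasDerivAt_fderiv_line hF 0 ω t
  have hBd (r : ℝ) : HasDerivAt (fun r => r ^ 2 * A r) (2 * r * A r + r ^ 2 * A' r) r := by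
    simpa using (hasDerivAt_pow 2 r).fun_mul (hAd r)
  set G : ℝ → ℝ := fun r => (2 * r * A r + r ^ 2 * A' r) - r ^ 2 * L r with hG
  have hGc : Continuous G := by fun_prop
  have hae : ∀ᵐ r ∂(volume : Measure ℝ), r ∈ Set.Ioi (0 : ℝ) → G r = 0 := by
    refine isOpen_Ioi.ae_eq_zero_of_integral_contDiff_smul_eq_zero
      (hGc.locallyIntegrable.locallyIntegrableOn _) fun ψ hψ hψc hψs => ?_
    have hψ' : Continuous (deriv ψ) := hψ.continuous_deriv (by simp)
    have hχ := contDiff_comp_norm hψ hψs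
    have hχc := hasCompactSupport_comp_norm hψc
    have hψ0 {r : ℝ} (hr : r ∉ Set.Ioi (0 : ℝ)) : ψ r = 0 :=
      image_eq_zero_of_notMem_tsupport fun h => hr (hψs h)
    have hψ'0 {r : ℝ} (hr : r ∉ Set.Ioi (0 : ℝ)) : deriv ψ r = 0 :=
      image_eq_zero_of_notMem_tsupport fun h => hr (hψs (tsupport_deriv_subset h))
    have hn {r : ℝ} (hr : r ∈ Set.Ioi (0 : ℝ))
        (ω : Metric.sphere (0 : EuclideanSpace ℝ (Fin 3)) 1) :
        ‖r • (ω : EuclideanSpace ℝ (Fin 3))‖ = r := by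
      rw [norm_smul, norm_eq_of_mem_sphere, mul_one, Real.norm_of_nonneg (le_of_lt hr)]
    have e1 : ∫ y : EuclideanSpace ℝ (Fin 3), ψ ‖y‖ * lap F y = ∫ r, ψ r * (r ^ 2 * L r) := by
      have hint : Integrable fun y : EuclideanSpace ℝ (Fin 3) => ψ ‖y‖ * lap F y :=
        (hχ.continuous.mul hFl).integrable_of_hasCompactSupport hχc.mul_right
      rw [integral_eq_integral_sphere σ hpolar hint,
        ← setIntegral_eq_integral_of_forall_compl_eq_zero (s := Set.Ioi (0 : ℝ))
          (f := fun r => ψ r * (r ^ 2 * L r)) (fun r hr => by rw [hψ0 hr, zero_mul])]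
      refine setIntegral_congr_fun measurableSet_Ioi fun r hr => ?_
      simp only [hn hr, integral_const_mul, hL]
      ring
    have e2 : ∫ y : EuclideanSpace ℝ (Fin 3), ∑ i : Fin 3,
        fderiv ℝ (fun y => ψ ‖y‖) y (EuclideanSpace.single i 1) *
          fderiv ℝ F y (EuclideanSpace.single i 1) = ∫ r, deriv ψ r * (r ^ 2 * A r) := by
      have hint : Integrable fun y : EuclideanSpace ℝ (Fin 3) => ∑ i : Fin 3,
          fderiv ℝ (fun y => ψ ‖y‖) y (EuclideanSpace.single i 1) *
            fderiv ℝ F y (EuclideanSpace.single i 1) := by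
        refine integrable_finsetSum _ fun i _ => ?_
        exact (((hχ.continuous_fderiv (by simp)).clm_apply continuous_const).mul
          (hF1.clm_apply continuous_const)).integrable_of_hasCompactSupport
            (hχc.fderiv_apply ℝ _).mul_right
      rw [integral_eq_integral_sphere σ hpolar hint,
        ← setIntegral_eq_integral_of_forall_compl_eq_zero (s := Set.Ioi (0 : ℝ))
          (f := fun r => deriv ψ r * (r ^ 2 * A r)) (fun r hr => by rw [hψ'0 hr, zero_mul])]
      refine setIntegral_congr_fun measurableSet_Ioi fun r hr => ?_
      simp only [fderiv_comp_norm_smul_sphere (hψ.differentiable (by simp)) hr, mul_assoc,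
        ← Finset.mul_sum, sum_inner_mul_clm, integral_const_mul, hA]
      ring
    have hd : Continuous fun r => 2 * r * A r + r ^ 2 * A' r := by fun_prop
    have j1 : Integrable fun r => ψ r * (2 * r * A r + r ^ 2 * A' r) :=
      (hψ.continuous.mul hd).integrable_of_hasCompactSupport hψc.mul_right
    have j2 : Integrable fun r => deriv ψ r * (r ^ 2 * A r) :=
      (hψ'.mul (by fun_prop)).integrable_of_hasCompactSupport hψc.deriv.mul_right
    have j3 : Integrable fun r => ψ r * (r ^ 2 * A r) :=
      (hψ.continuous.mul (by fun_prop)).integrable_of_hasCompactSupport hψc.mul_right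
    have j4 : Integrable fun r => ψ r * (r ^ 2 * L r) :=
      (hψ.continuous.mul (by fun_prop)).integrable_of_hasCompactSupport hψc.mul_right
    have e3 := integral_mul_deriv_eq_deriv_mul_of_integrable (u := ψ) (u' := deriv ψ)
      (fun r _ => ((hψ.differentiable (by simp)) r).hasDerivAt) (fun r _ => hBd r) j1 j2 j3
    have e4 := integral_mul_lap_eq_neg hχ hχc hF
    rw [e1, e2, ← e3] at e4
    simp only [hG, smul_eq_mul, mul_sub]
    rw [integral_sub j1 j4, e4, sub_self]
  have h1 : G 1 = 0 :=
    Measure.eqOn_open_of_ae_eq (f := G) (g := 0)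
      ((ae_restrict_iff' measurableSet_Ioi).2 hae) isOpen_Ioi
      hGc.continuousOn continuousOn_const (Set.mem_Ioi.2 one_pos)
  simp only [hG, hA, hA', hL, one_smul] at h1
  linarith

theorem fderiv_comp_add_smul {W : Type*} [NormedAddCommGroup W] [NormedSpace ℝ W]
    {g : EuclideanSpace ℝ (Fin 3) → W} (hg : Differentiable ℝ g) (x : EuclideanSpace ℝ (Fin 3))
    (t : ℝ) (y : EuclideanSpace ℝ (Fin 3)) :
    fderiv ℝ (fun z => g (x + t • z)) y = t • fderiv ℝ g (x + t • y) := by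
  have h1 : HasFDerivAt (fun z : EuclideanSpace ℝ (Fin 3) => x + t • z)
      (t • ContinuousLinearMap.id ℝ (EuclideanSpace ℝ (Fin 3))) y :=
    ((hasFDerivAt_id y).const_smul t).const_add x
  have h2 := ((hg (x + t • y)).hasFDerivAt.comp y h1).fderiv
  simp only [Function.comp_def] at h2
  rw [h2]
  ext w
  simp

theorem lap_comp_add_smul {F : EuclideanSpace ℝ (Fin 3) → ℝ} (hF : ContDiff ℝ (⊤ : ℕ∞) F)
    (x : EuclideanSpace ℝ (Fin 3)) (t : ℝ) (y : EuclideanSpace ℝ (Fin 3)) :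
    lap (fun z => F (x + t • z)) y = t ^ 2 * lap F (x + t • y) := by
  have hF1 (v : EuclideanSpace ℝ (Fin 3)) : Differentiable ℝ fun y => fderiv ℝ F y v :=
    ((hF.fderiv_right (m := (⊤ : ℕ∞)) (by simp)).clm_apply contDiff_const).differentiable (by simp)
  simp only [lap, Finset.mul_sum]
  refine Finset.sum_congr rfl fun i _ => ?_
  simp only [fderiv_comp_add_smul (hF.differentiable (by simp)), FunLike.coe_smul,
    Pi.smul_apply, smul_eq_mul]
  have hd : DifferentiableAt ℝ
      (fun z => fderiv ℝ F (x + t • z) (EuclideanSpace.single i 1)) y :=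
    ((hF1 (EuclideanSpace.single i 1)).comp (by fun_prop : Differentiable ℝ
      fun z : EuclideanSpace ℝ (Fin 3) => x + t • z)) y
  rw [fderiv_const_mul hd, fderiv_comp_add_smul (hF1 (EuclideanSpace.single i 1))]
  simp
  ring

theorem integral_sphere_lap_add_smul
    (σ : Measure (Metric.sphere (0 : EuclideanSpace ℝ (Fin 3)) 1)) [IsFiniteMeasure σ]
    (hpolar : ∀ h : EuclideanSpace ℝ (Fin 3) → ℝ≥0∞, Measurable h →
      ∫⁻ y, h y = ∫⁻ r in Set.Ioi (0 : ℝ),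
        (∫⁻ ω, h (r • (ω : EuclideanSpace ℝ (Fin 3))) ∂σ) * ENNReal.ofReal (r ^ 2))
    {F : EuclideanSpace ℝ (Fin 3) → ℝ} (hF : ContDiff ℝ (⊤ : ℕ∞) F)
    (x : EuclideanSpace ℝ (Fin 3)) (t : ℝ) :
    t ^ 2 * ∫ ω, fderiv ℝ (fderiv ℝ F) (x + t • (ω : EuclideanSpace ℝ (Fin 3))) ω ω ∂σ +
      2 * (t * ∫ ω, fderiv ℝ F (x + t • (ω : EuclideanSpace ℝ (Fin 3))) ω ∂σ) =
      t ^ 2 * ∫ ω, lap F (x + t • (ω : EuclideanSpace ℝ (Fin 3))) ∂σ := by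
  have hF' : Differentiable ℝ (fderiv ℝ F) :=
    (hF.fderiv_right (m := (⊤ : ℕ∞)) (by simp)).differentiable (by simp)
  have h1 : fderiv ℝ (fun z => F (x + t • z)) = fun y => t • fderiv ℝ F (x + t • y) :=
    funext (fderiv_comp_add_smul (hF.differentiable (by simp)) x t)
  have h2 (y : EuclideanSpace ℝ (Fin 3)) : fderiv ℝ (fderiv ℝ (fun z => F (x + t • z))) y =
      t • t • fderiv ℝ (fderiv ℝ F) (x + t • y) := by
    have hd : DifferentiableAt ℝ (fun z => fderiv ℝ F (x + t • z)) y :=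
      (hF'.comp (by fun_prop : Differentiable ℝ
        fun z : EuclideanSpace ℝ (Fin 3) => x + t • z)) y
    rw [h1, fderiv_fun_const_smul hd, fderiv_comp_add_smul hF']
  have key := integral_sphere_lap σ hpolar (hF.comp (by fun_prop :
    ContDiff ℝ (⊤ : ℕ∞) fun z : EuclideanSpace ℝ (Fin 3) => x + t • z))
  simp only [Function.comp_def, h2, lap_comp_add_smul hF, integral_const_mul] at key
  simp only [h1, FunLike.coe_smul, Pi.smul_apply, smul_eq_mul,
    integral_const_mul] at key
  rw [← key]
  ring

theorem fderiv_integral_sphere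
    (σ : Measure (Metric.sphere (0 : EuclideanSpace ℝ (Fin 3)) 1)) [IsFiniteMeasure σ]
    {g : EuclideanSpace ℝ (Fin 3) → ℝ} (hg : ContDiff ℝ 1 g) (t : ℝ)
    (x v : EuclideanSpace ℝ (Fin 3)) :
    fderiv ℝ (fun y => ∫ ω, g (y + t • (ω : EuclideanSpace ℝ (Fin 3))) ∂σ) x v =
      ∫ ω, fderiv ℝ g (x + t • (ω : EuclideanSpace ℝ (Fin 3))) v ∂σ := by
  have hg' : Continuous (fderiv ℝ g) := hg.continuous_fderiv one_ne_zero
  have hg0 := hg.continuous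
  have h := hasFDerivAt_integral_of_compactSpace (μ := σ)
    (h := fun y (ω : Metric.sphere (0 : EuclideanSpace ℝ (Fin 3)) 1) =>
      g (y + t • (ω : EuclideanSpace ℝ (Fin 3))))
    (h' := fun y ω => fderiv ℝ g (y + t • (ω : EuclideanSpace ℝ (Fin 3))))
    (fun p => by fun_prop) (by fun_prop)
    (fun p ω => (hasFDerivAt_comp_add_right _).2 ((hg.differentiable one_ne_zero) _).hasFDerivAt) x
  rw [h.fderiv, ContinuousLinearMap.integral_apply]
  exact Continuous.integrable_of_compactSpace (by fun_prop)

theorem lap_integral_sphere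
    (σ : Measure (Metric.sphere (0 : EuclideanSpace ℝ (Fin 3)) 1)) [IsFiniteMeasure σ]
    {F : EuclideanSpace ℝ (Fin 3) → ℝ} (hF : ContDiff ℝ (⊤ : ℕ∞) F) (c t : ℝ)
    (x : EuclideanSpace ℝ (Fin 3)) :
    lap (fun y => c * ∫ ω, F (y + t • (ω : EuclideanSpace ℝ (Fin 3))) ∂σ) x =
      c * ∫ ω, lap F (x + t • (ω : EuclideanSpace ℝ (Fin 3))) ∂σ := by
  have hF1 (v : EuclideanSpace ℝ (Fin 3)) : ContDiff ℝ (⊤ : ℕ∞) fun y => fderiv ℝ F y v :=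
    (hF.fderiv_right (m := (⊤ : ℕ∞)) (by simp)).clm_apply contDiff_const
  have hF2 (v : EuclideanSpace ℝ (Fin 3)) :
      Continuous fun y => fderiv ℝ (fun z => fderiv ℝ F z v) y v :=
    ((hF1 v).continuous_fderiv (by simp)).clm_apply continuous_const
  have hs {g : EuclideanSpace ℝ (Fin 3) → ℝ} (hg : ContDiff ℝ (⊤ : ℕ∞) g) :
      Differentiable ℝ fun y => ∫ ω, g (y + t • (ω : EuclideanSpace ℝ (Fin 3))) ∂σ :=
    (contDiff_integral_of_compactSpace (μ := σ) continuous_subtype_val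
      (g := fun q : EuclideanSpace ℝ (Fin 3) × EuclideanSpace ℝ (Fin 3) => g (q.1 + t • q.2))
      (hg.comp (by fun_prop))).differentiable (by simp)
  have hd {g : EuclideanSpace ℝ (Fin 3) → ℝ} (hg : ContDiff ℝ (⊤ : ℕ∞) g)
      (y v : EuclideanSpace ℝ (Fin 3)) :
      fderiv ℝ (fun y => c * ∫ ω, g (y + t • (ω : EuclideanSpace ℝ (Fin 3))) ∂σ) y v =
        c * ∫ ω, fderiv ℝ g (y + t • (ω : EuclideanSpace ℝ (Fin 3))) v ∂σ := by
    rw [fderiv_const_mul (hs hg y), ← fderiv_integral_sphere σ (hg.of_le (by simp)) t y v]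
    simp
  simp only [lap, hd hF, hd (hF1 _)]
  rw [integral_finsetSum _ fun i _ => ?_, Finset.mul_sum]
  exact ((hF2 _).comp (by fun_prop)).integrable_of_compactSpace

theorem hasDerivAt_integral_sphere
    (σ : Measure (Metric.sphere (0 : EuclideanSpace ℝ (Fin 3)) 1)) [IsFiniteMeasure σ]
    {F : EuclideanSpace ℝ (Fin 3) → ℝ} (hF : ContDiff ℝ (⊤ : ℕ∞) F)
    (x : EuclideanSpace ℝ (Fin 3)) (t : ℝ) :
    HasDerivAt (fun s => ∫ ω, F (x + s • (ω : EuclideanSpace ℝ (Fin 3))) ∂σ)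
      (∫ ω, fderiv ℝ F (x + t • (ω : EuclideanSpace ℝ (Fin 3))) ω ∂σ) t := by
  have hF0 := hF.continuous
  have hF1 : Continuous (fderiv ℝ F) := hF.continuous_fderiv (by simp)
  refine hasDerivAt_integral_of_compactSpace (μ := σ)
    (h := fun (s : ℝ) (ω : Metric.sphere (0 : EuclideanSpace ℝ (Fin 3)) 1) =>
      F (x + s • (ω : EuclideanSpace ℝ (Fin 3))))
    (h' := fun (s : ℝ) (ω : Metric.sphere (0 : EuclideanSpace ℝ (Fin 3)) 1) =>
      fderiv ℝ F (x + s • (ω : EuclideanSpace ℝ (Fin 3))) ω)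
    (fun t => by fun_prop) (by fun_prop) (fun t ω => ?_) t
  have h2 : HasDerivAt (fun s : ℝ => x + s • (ω : EuclideanSpace ℝ (Fin 3))) ω t := by
    simpa using ((hasDerivAt_id t).smul_const (ω : EuclideanSpace ℝ (Fin 3))).const_add x
  exact ((hF.differentiable (by simp)) _).hasFDerivAt.comp_hasDerivAt t h2

theorem hasDerivAt_integral_sphere_fderiv
    (σ : Measure (Metric.sphere (0 : EuclideanSpace ℝ (Fin 3)) 1)) [IsFiniteMeasure σ]
    {F : EuclideanSpace ℝ (Fin 3) → ℝ} (hF : ContDiff ℝ (⊤ : ℕ∞) F)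
    (x : EuclideanSpace ℝ (Fin 3)) (t : ℝ) :
    HasDerivAt (fun s => ∫ ω, fderiv ℝ F (x + s • (ω : EuclideanSpace ℝ (Fin 3))) ω ∂σ)
      (∫ ω, fderiv ℝ (fderiv ℝ F) (x + t • (ω : EuclideanSpace ℝ (Fin 3))) ω ω ∂σ) t := by
  have hF' : ContDiff ℝ (⊤ : ℕ∞) (fderiv ℝ F) := hF.fderiv_right (by simp)
  have hF1 : Continuous (fderiv ℝ F) := hF'.continuous
  have hF2 : Continuous (fderiv ℝ (fderiv ℝ F)) := hF'.continuous_fderiv (by simp)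
  exact hasDerivAt_integral_of_compactSpace (μ := σ)
    (h := fun (s : ℝ) (ω : Metric.sphere (0 : EuclideanSpace ℝ (Fin 3)) 1) =>
      fderiv ℝ F (x + s • (ω : EuclideanSpace ℝ (Fin 3))) ω)
    (h' := fun (s : ℝ) (ω : Metric.sphere (0 : EuclideanSpace ℝ (Fin 3)) 1) =>
      fderiv ℝ (fderiv ℝ F) (x + s • (ω : EuclideanSpace ℝ (Fin 3))) ω ω)
    (fun t => by fun_prop) (by fun_prop) (fun t ω => hasDerivAt_fderiv_line hF x ω t) t

/-- **Kirchhoff's formula** for `sin(t√(−Δ))/√(−Δ) f`: if `σ` is the surface measure on the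
unit sphere `S² ⊂ ℝ³` (characterized by `σ(S²) = 4π` and the polar coordinates formula)
and `f` is Schwartz, then `u(x,t) = (t/4π) ∫_{S²} f(x + tω) dσ(ω)` is smooth, solves the
wave equation `∂ₜ²u = Δₓu`, and has initial data `u(·,0) = 0`, `∂ₜu(·,0) = f`. -/
theorem stmt_11
    (σ : Measure (Metric.sphere (0 : EuclideanSpace ℝ (Fin 3)) 1))
    (hσ : σ Set.univ = ENNReal.ofReal (4 * Real.pi))
    (hpolar : ∀ h : EuclideanSpace ℝ (Fin 3) → ℝ≥0∞, Measurable h →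
      ∀ x : EuclideanSpace ℝ (Fin 3),
        ∫⁻ y, h y = ∫⁻ r in Set.Ioi (0 : ℝ),
          (∫⁻ ω, h (x + r • (ω : EuclideanSpace ℝ (Fin 3))) ∂σ) * ENNReal.ofReal (r ^ 2))
    (f : SchwartzMap (EuclideanSpace ℝ (Fin 3)) ℝ)
    (u : EuclideanSpace ℝ (Fin 3) → ℝ → ℝ)
    (hu : ∀ (x : EuclideanSpace ℝ (Fin 3)) (t : ℝ),
      u x t = (t / (4 * Real.pi)) * ∫ ω, f (x + t • (ω : EuclideanSpace ℝ (Fin 3))) ∂σ) :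
    ContDiff ℝ (⊤ : ℕ∞) (fun p : EuclideanSpace ℝ (Fin 3) × ℝ => u p.1 p.2) ∧
    (∀ (x : EuclideanSpace ℝ (Fin 3)) (t : ℝ),
      deriv (deriv (u x)) t = lap (fun y => u y t) x) ∧
    (∀ x : EuclideanSpace ℝ (Fin 3), u x 0 = 0) ∧
    (∀ x : EuclideanSpace ℝ (Fin 3), deriv (u x) 0 = f x) := by
  have hfin : IsFiniteMeasure σ := ⟨by rw [hσ]; exact ENNReal.ofReal_lt_top⟩
  have hpol := fun (h : EuclideanSpace ℝ (Fin 3) → ℝ≥0∞) (hh : Measurable h) => hpolar h hh 0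
  simp only [zero_add] at hpol
  have hf : ContDiff ℝ (⊤ : ℕ∞) f := f.smooth _
  have hπ : (4 * Real.pi) ≠ 0 := by positivity
  set M : EuclideanSpace ℝ (Fin 3) → ℝ → ℝ :=
    fun x t => ∫ ω, f (x + t • (ω : EuclideanSpace ℝ (Fin 3))) ∂σ with hM
  set M₁ : EuclideanSpace ℝ (Fin 3) → ℝ → ℝ :=
    fun x t => ∫ ω, fderiv ℝ f (x + t • (ω : EuclideanSpace ℝ (Fin 3))) ω ∂σ with hM₁
  set M₂ : EuclideanSpace ℝ (Fin 3) → ℝ → ℝ :=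
    fun x t => ∫ ω, fderiv ℝ (fderiv ℝ f) (x + t • (ω : EuclideanSpace ℝ (Fin 3))) ω ω ∂σ with hM₂
  have hMd (x t) : HasDerivAt (M x) (M₁ x t) t := hasDerivAt_integral_sphere σ hf x t
  have hM₁d (x t) : HasDerivAt (M₁ x) (M₂ x t) t := hasDerivAt_integral_sphere_fderiv σ hf x t
  have hux (x) : u x = fun t => (t / (4 * Real.pi)) * M x t := funext (hu x)
  have hd1 (x t) : HasDerivAt (u x) (1 / (4 * Real.pi) * M x t + t / (4 * Real.pi) * M₁ x t) t := by
    rw [hux]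
    exact ((hasDerivAt_id t).div_const _).fun_mul (hMd x t)
  have hd1' (x) : deriv (u x) = fun t => 1 / (4 * Real.pi) * M x t + t / (4 * Real.pi) * M₁ x t :=
    funext fun t => (hd1 x t).deriv
  have hd2 (x t) : HasDerivAt (deriv (u x)) (1 / (4 * Real.pi) * M₁ x t +
      (1 / (4 * Real.pi) * M₁ x t + t / (4 * Real.pi) * M₂ x t)) t := by
    rw [hd1']
    exact ((hMd x t).const_mul _).add (((hasDerivAt_id t).div_const _).fun_mul (hM₁d x t))
  refine ⟨?_, fun x t => ?_, fun x => by simp [hu], fun x => ?_⟩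
  · simp only [hu]
    refine ContDiff.mul (by fun_prop) ?_
    exact contDiff_integral_of_compactSpace (μ := σ) continuous_subtype_val
      (g := fun q : (EuclideanSpace ℝ (Fin 3) × ℝ) × EuclideanSpace ℝ (Fin 3) =>
        f (q.1.1 + q.1.2 • q.2)) (hf.comp (by fun_prop))
  · have hlap : lap (fun y => u y t) x = t / (4 * Real.pi) *
        ∫ ω, lap f (x + t • (ω : EuclideanSpace ℝ (Fin 3))) ∂σ := by
      simp only [hu]
      exact lap_integral_sphere σ hf _ t x
    have hM₂c : Continuous (M₂ x) := by
      have hF' : ContDiff ℝ (⊤ : ℕ∞) (fderiv ℝ f) := hf.fderiv_right (by simp)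
      have hF2 : Continuous (fderiv ℝ (fderiv ℝ f)) := hF'.continuous_fderiv (by simp)
      exact continuous_integral_of_compactSpace (μ := σ)
        (h := fun (s : ℝ) (ω : Metric.sphere (0 : EuclideanSpace ℝ (Fin 3)) 1) =>
          fderiv ℝ (fderiv ℝ f) (x + s • (ω : EuclideanSpace ℝ (Fin 3))) ω ω) (by fun_prop)
    have hM₁c : Continuous (M₁ x) :=
      continuous_iff_continuousAt.2 fun s => (hM₁d x s).continuousAt
    have hLc : Continuous fun s : ℝ =>
        ∫ ω, lap f (x + s • (ω : EuclideanSpace ℝ (Fin 3))) ∂σ := by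
      have hl := continuous_lap hf
      exact continuous_integral_of_compactSpace (μ := σ)
        (h := fun (s : ℝ) (ω : Metric.sphere (0 : EuclideanSpace ℝ (Fin 3)) 1) =>
          lap f (x + s • (ω : EuclideanSpace ℝ (Fin 3)))) (by fun_prop)
    have key : (fun s => 2 * M₁ x s + s * M₂ x s) = fun s =>
        s * ∫ ω, lap f (x + s • (ω : EuclideanSpace ℝ (Fin 3))) ∂σ := by
      refine Continuous.ext_on (dense_compl_singleton (0 : ℝ)) (by fun_prop) (by fun_prop)
        fun s hs => ?_
      have h := integral_sphere_lap_add_smul σ hpol hf x s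
      refine mul_left_cancel₀ (show s ≠ 0 from hs) ?_
      simp only [hM₁, hM₂]
      linear_combination h
    rw [hlap, (hd2 x t).deriv]
    have hk := congrFun key t
    linear_combination (1 / (4 * Real.pi)) * hk
  · rw [(hd1 x 0).deriv]
    have : σ.real Set.univ = 4 * Real.pi := by
      rw [Measure.real, hσ, ENNReal.toReal_ofReal (by positivity)]
    simp only [hM, zero_smul, add_zero, integral_const, this, smul_eq_mul]
    field_simp
    simp
end

section
/- Let λ ∈ ℂ with Im λ ≥ 0 and let f : ℝ³ → ℂ be a Schwartz function. Define u : ℝ³ → ℂ by u(x) = ∫_{ℝ³} e^{iλ‖x−y‖} / (4π‖x−y‖) f(y) dy (the integral converges absolutely). Then u is twice continuously differentiable and satisfies −Δu(x) − λ² u(x) = f(x) for all x ∈ ℝ³. (Thus the free resolvent R₀(λ²) = (−Δ − λ²)^{-1} with outgoing boundary condition has integral kernel R₀(λ²)(x, y) = e^{iλ‖x−y‖}/(4π‖x−y‖).) -/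
open MeasureTheory

/-- The Euclidean Laplacian `Δf(x) = ∑ᵢ ∂²f/∂xᵢ²` for complex-valued functions on `ℝ³`. -/
noncomputable def lapC (f : EuclideanSpace ℝ (Fin 3) → ℂ) (x : EuclideanSpace ℝ (Fin 3)) : ℂ :=
  ∑ i : Fin 3,
    fderiv ℝ (fun y => fderiv ℝ f y (EuclideanSpace.single i 1)) x (EuclideanSpace.single i 1)

open scoped SchwartzMap LineDeriv Topology
open Filter

/-- A Schwartz function composed with `z ↦ x - z` decays faster than any power, locally uniformly
in `x`. -/
theorem SchwartzMap.exists_norm_sub_le {E F : Type*} [NormedAddCommGroup E] [NormedSpace ℝ E]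
    [NormedAddCommGroup F] [NormedSpace ℝ F] (f : 𝓢(E, F)) (x₀ : E) (k : ℕ) :
    ∃ C : ℝ, 0 ≤ C ∧ ∀ x ∈ Metric.ball x₀ 1, ∀ z, ‖f (x - z)‖ ≤ C * ((1 + ‖z‖) ^ k)⁻¹ := by
  set S := 2 ^ k * (Finset.Iic (k, 0)).sup (fun m => SchwartzMap.seminorm ℝ m.1 m.2) f
  have hS (y : E) : (1 + ‖y‖) ^ k * ‖f y‖ ≤ S := by
    simpa using SchwartzMap.one_add_le_sup_seminorm_apply (𝕜 := ℝ) (m := (k, 0)) le_rfl le_rfl f y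
  have hS0 : 0 ≤ S := le_trans (by positivity) (hS 0)
  refine ⟨(2 + ‖x₀‖) ^ k * S, by positivity, fun x hx z => ?_⟩
  rw [← div_eq_mul_inv, le_div_iff₀ (by positivity)]
  have hz : 1 + ‖z‖ ≤ (2 + ‖x₀‖) * (1 + ‖x - z‖) := by
    have h1 : ‖z‖ ≤ ‖x - z‖ + ‖x‖ := by
      simpa [add_comm] using norm_sub_le x (x - z)
    have h2 : ‖x‖ ≤ ‖x₀‖ + 1 := by
      have := norm_add_le x₀ (x - x₀)
      rw [Metric.mem_ball, dist_eq_norm] at hx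
      simp only [add_sub_cancel] at this
      linarith
    nlinarith [norm_nonneg x₀, norm_nonneg (x - z), mul_nonneg (norm_nonneg x₀) (norm_nonneg (x - z))]
  calc ‖f (x - z)‖ * (1 + ‖z‖) ^ k
      ≤ ‖f (x - z)‖ * ((2 + ‖x₀‖) * (1 + ‖x - z‖)) ^ k := by gcongr
    _ = (2 + ‖x₀‖) ^ k * ((1 + ‖x - z‖) ^ k * ‖f (x - z)‖) := by rw [mul_pow]; ring
    _ ≤ (2 + ‖x₀‖) ^ k * S := by gcongr; exact hS _

section TemperedKernel

variable {E F : Type*} [NormedAddCommGroup E] [NormedSpace ℝ E] [MeasurableSpace E]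
  [NormedAddCommGroup F] [NormedSpace ℝ F] [NormedSpace ℂ F] {μ : Measure E}

/-- A scalar kernel that is integrable against some negative power of `1 + ‖z‖`. -/
def TemperedKernel (μ : Measure E) (K : E → ℂ) : Prop :=
  AEStronglyMeasurable K μ ∧ ∃ k : ℕ, Integrable (fun z => ‖K z‖ * ((1 + ‖z‖) ^ k)⁻¹) μ

namespace TemperedKernel

variable {K : E → ℂ}

theorem exists_bound (hK : TemperedKernel μ K) (f : 𝓢(E, F)) (x₀ : E) :
    ∃ b : E → ℝ, Integrable b μ ∧ ∀ x ∈ Metric.ball x₀ 1, ∀ z, ‖K z • f (x - z)‖ ≤ b z := by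
  obtain ⟨k, hk⟩ := hK.2
  obtain ⟨C, -, hC⟩ := f.exists_norm_sub_le x₀ k
  refine ⟨_, hk.const_mul C, fun x hx z => ?_⟩
  rw [norm_smul]
  calc ‖K z‖ * ‖f (x - z)‖ ≤ ‖K z‖ * (C * ((1 + ‖z‖) ^ k)⁻¹) := by gcongr; exact hC x hx z
    _ = _ := by ring

variable [BorelSpace E] [SecondCountableTopology E]

theorem aestronglyMeasurable_smul (hK : TemperedKernel μ K) (f : 𝓢(E, F)) (x : E) :
    AEStronglyMeasurable (fun z => K z • f (x - z)) μ :=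
  hK.1.smul (f.continuous.comp (continuous_const.sub continuous_id)).aestronglyMeasurable

theorem integrable_smul (hK : TemperedKernel μ K) (f : 𝓢(E, F)) (x : E) :
    Integrable (fun z => K z • f (x - z)) μ := by
  obtain ⟨b, hb, hle⟩ := hK.exists_bound f x
  exact hb.mono' (hK.aestronglyMeasurable_smul f x)
    (Eventually.of_forall (hle x (Metric.mem_ball_self one_pos)))

variable [SMulCommClass ℝ ℂ F]

theorem hasFDerivAt_integral (hK : TemperedKernel μ K) (f : 𝓢(E, F)) (x : E) :
    HasFDerivAt (fun x => ∫ z, K z • f (x - z) ∂μ)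
      (∫ z, K z • SchwartzMap.fderivCLM ℝ E F f (x - z) ∂μ) x := by
  obtain ⟨b, hb, hle⟩ := hK.exists_bound (SchwartzMap.fderivCLM ℝ E F f) x
  refine hasFDerivAt_integral_of_dominated_of_fderiv_le
    (F' := fun x z => K z • SchwartzMap.fderivCLM ℝ E F f (x - z))
    (Metric.ball_mem_nhds x one_pos)
    (Eventually.of_forall (hK.aestronglyMeasurable_smul f)) (hK.integrable_smul f x)
    (hK.aestronglyMeasurable_smul _ x) (Eventually.of_forall fun z y hy => hle y hy z) hb
    (Eventually.of_forall fun z y _ => ?_)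
  exact ((f.hasFDerivAt (y - z)).comp y ((hasFDerivAt_id y).sub_const z)).const_smul (K z)

theorem contDiff_one_integral (hK : TemperedKernel μ K) (f : 𝓢(E, F)) :
    ContDiff ℝ 1 (fun x => ∫ z, K z • f (x - z) ∂μ) :=
  contDiff_one_iff_hasFDerivAt.2 ⟨_, continuous_iff_continuousAt.2
    fun x => (hK.hasFDerivAt_integral (SchwartzMap.fderivCLM ℝ E F f) x).continuousAt,
    hK.hasFDerivAt_integral f⟩

theorem contDiff_two_integral (hK : TemperedKernel μ K) (f : 𝓢(E, F)) :
    ContDiff ℝ 2 (fun x => ∫ z, K z • f (x - z) ∂μ) :=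
  (contDiff_succ_iff_hasFDerivAt (n := 1)).2
    ⟨_, hK.contDiff_one_integral (SchwartzMap.fderivCLM ℝ E F f), hK.hasFDerivAt_integral f⟩

theorem fderiv_integral_apply [CompleteSpace F] (hK : TemperedKernel μ K) (f : 𝓢(E, F)) (x v : E) :
    fderiv ℝ (fun x => ∫ z, K z • f (x - z) ∂μ) x v =
      ∫ z, K z • (∂_{v} f : 𝓢(E, F)) (x - z) ∂μ := by
  rw [(hK.hasFDerivAt_integral f x).fderiv,
    ContinuousLinearMap.integral_apply (hK.integrable_smul _ x)]
  rfl

/-- Integration by parts: the derivative may be moved from the Schwartz function to the kernel. -/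
theorem integral_smul_lineDeriv [FiniteDimensional ℝ E] [μ.IsAddHaarMeasure]
    {A A' : E → ℂ} (hA : TemperedKernel μ A) (hA' : TemperedKernel μ A') {v : E}
    (hd : ∀ z, HasLineDerivAt ℝ A (A' z) z v) (f : 𝓢(E, ℂ)) (x : E) :
    ∫ z, A z • (∂_{v} f : 𝓢(E, ℂ)) (x - z) ∂μ = ∫ z, A' z • f (x - z) ∂μ := by
  have key := integral_bilinear_hasLineDerivAt_right_eq_neg_left_of_integrable (μ := μ)
    (f := A) (f' := A') (g := fun z => f (x - z)) (g' := fun z => -(∂_{v} f : 𝓢(E, ℂ)) (x - z))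
    (B := ContinuousLinearMap.mul ℝ ℂ) (v := v)
    (by simpa using hA'.integrable_smul f x)
    (by simpa using (hA.integrable_smul (∂_{v} f : 𝓢(E, ℂ)) x).neg)
    (by simpa using hA.integrable_smul f x) (fun z _ => hd z) ?_
  · simpa [integral_neg] using key
  · intro z _
    have := ((f.hasFDerivAt (x - z)).comp z ((hasFDerivAt_id z).const_sub x)).hasLineDerivAt v
    simpa [SchwartzMap.lineDerivOp_apply_eq_fderiv, Function.comp_def] using this

end TemperedKernel

end TemperedKernel

section Profiles

/-- The radial profile `e^{iλs}/s` of the outgoing Helmholtz kernel (without the factor `4π`). -/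
noncomputable def helmholtzProfile (lam : ℂ) (s : ℝ) : ℂ :=
  Complex.exp (Complex.I * lam * s) * (s : ℂ)⁻¹

/-- The derivative of `helmholtzProfile` divided by `s`. -/
noncomputable def helmholtzProfileDeriv (lam : ℂ) (s : ℝ) : ℂ :=
  Complex.exp (Complex.I * lam * s) * (Complex.I * lam * (s : ℂ)⁻¹ ^ 2 - (s : ℂ)⁻¹ ^ 3)

/-- The derivative of `helmholtzProfileDeriv` divided by `s`. -/
noncomputable def helmholtzProfileDeriv₂ (lam : ℂ) (s : ℝ) : ℂ :=
  Complex.exp (Complex.I * lam * s) *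
    (-lam ^ 2 * (s : ℂ)⁻¹ ^ 3 - 3 * Complex.I * lam * (s : ℂ)⁻¹ ^ 4 + 3 * (s : ℂ)⁻¹ ^ 5)

variable {lam : ℂ}

theorem norm_exp_I_mul_le_one (hlam : 0 ≤ lam.im) {s : ℝ} (hs : 0 ≤ s) :
    ‖Complex.exp (Complex.I * lam * s)‖ ≤ 1 := by
  rw [Complex.norm_exp, Real.exp_le_one_iff]
  simp
  positivity

theorem hasDerivAt_exp_I_mul (lam s : ℂ) :
    HasDerivAt (fun s : ℂ => Complex.exp (Complex.I * lam * s))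
      (Complex.exp (Complex.I * lam * s) * (Complex.I * lam)) s := by
  simpa using ((hasDerivAt_id s).const_mul (Complex.I * lam)).cexp

theorem hasDerivAt_helmholtzProfile {s : ℝ} (hs : 0 < s) :
    HasDerivAt (helmholtzProfile lam) (helmholtzProfileDeriv lam s * s) s := by
  have hs' : (s : ℂ) ≠ 0 := by exact_mod_cast hs.ne'
  have h := ((hasDerivAt_exp_I_mul lam s).mul (hasDerivAt_inv hs')).comp_ofReal
  refine HasDerivAt.congr_deriv h ?_
  simp only [helmholtzProfileDeriv]
  field_simp
  ring

theorem hasDerivAt_helmholtzProfileDeriv {s : ℝ} (hs : 0 < s) :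
    HasDerivAt (helmholtzProfileDeriv lam) (helmholtzProfileDeriv₂ lam s * s) s := by
  have hs' : (s : ℂ) ≠ 0 := by exact_mod_cast hs.ne'
  have hi := hasDerivAt_inv hs'
  have h := ((hasDerivAt_exp_I_mul lam s).mul
    (((hi.pow 2).const_mul (Complex.I * lam)).sub (hi.pow 3))).comp_ofReal
  refine HasDerivAt.congr_deriv h ?_
  simp only [helmholtzProfileDeriv₂]
  have hI := Complex.I_sq
  simp
  field_simp
  linear_combination (lam ^ 2 * s ^ 2) * hI

theorem norm_helmholtzProfile_le (hlam : 0 ≤ lam.im) {s : ℝ} (hs : 0 ≤ s) :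
    ‖helmholtzProfile lam s‖ ≤ s⁻¹ := by
  rw [helmholtzProfile, norm_mul, norm_inv, Complex.norm_of_nonneg hs]
  exact mul_le_of_le_one_left (by positivity) (norm_exp_I_mul_le_one hlam hs)

theorem norm_helmholtzProfileDeriv_le (hlam : 0 ≤ lam.im) {s : ℝ} (hs : 0 ≤ s) :
    ‖helmholtzProfileDeriv lam s‖ ≤ ‖lam‖ * s⁻¹ ^ 2 + s⁻¹ ^ 3 := by
  rw [helmholtzProfileDeriv, norm_mul]
  refine (mul_le_of_le_one_left (norm_nonneg _) (norm_exp_I_mul_le_one hlam hs)).trans ?_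
  refine (norm_sub_le _ _).trans_eq ?_
  simp [abs_of_nonneg hs]

theorem norm_helmholtzProfileDeriv₂_le (hlam : 0 ≤ lam.im) {s : ℝ} (hs : 0 ≤ s) :
    ‖helmholtzProfileDeriv₂ lam s‖ ≤ ‖lam‖ ^ 2 * s⁻¹ ^ 3 + 3 * ‖lam‖ * s⁻¹ ^ 4 + 3 * s⁻¹ ^ 5 := by
  rw [helmholtzProfileDeriv₂, norm_mul]
  refine (mul_le_of_le_one_left (norm_nonneg _) (norm_exp_I_mul_le_one hlam hs)).trans ?_
  refine (norm_add_le _ _).trans ((add_le_add_left (norm_sub_le _ _) _).trans_eq ?_)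
  simp [abs_of_nonneg hs]

theorem helmholtzProfile_ode {s : ℝ} (hs : 0 < s) :
    helmholtzProfileDeriv₂ lam s * s ^ 2 + 3 * helmholtzProfileDeriv lam s
      + lam ^ 2 * helmholtzProfile lam s = 0 := by
  have hs' : (s : ℂ) ≠ 0 := by exact_mod_cast hs.ne'
  simp only [helmholtzProfileDeriv₂, helmholtzProfileDeriv, helmholtzProfile]
  field_simp
  ring

theorem continuousAt_helmholtzProfile {s : ℝ} (hs : 0 < s) :
    ContinuousAt (helmholtzProfile lam) s := (hasDerivAt_helmholtzProfile hs).continuousAt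

theorem continuousAt_helmholtzProfileDeriv {s : ℝ} (hs : 0 < s) :
    ContinuousAt (helmholtzProfileDeriv lam) s := (hasDerivAt_helmholtzProfileDeriv hs).continuousAt

theorem continuousAt_helmholtzProfileDeriv₂ {s : ℝ} (hs : 0 < s) :
    ContinuousAt (helmholtzProfileDeriv₂ lam) s := by
  have hs' : (s : ℂ) ≠ 0 := by exact_mod_cast hs.ne'
  unfold helmholtzProfileDeriv₂
  fun_prop (disch := assumption)

end Profiles

theorem integral_Ioi_sq_mul_inv_sqrt_pow :
    ∫ r in Set.Ioi (0 : ℝ), r ^ 2 * (√(r ^ 2 + 1 ^ 2))⁻¹ ^ 5 = 1 / 3 := by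
  have hd (r : ℝ) (_ : r ∈ Set.Ici 0) : HasDerivAt (fun r : ℝ => (r * (√(r ^ 2 + 1 ^ 2))⁻¹) ^ 3 / 3)
      (r ^ 2 * (√(r ^ 2 + 1 ^ 2))⁻¹ ^ 5) r := by
    have hp : 0 < √(r ^ 2 + 1 ^ 2) := by positivity
    have hsq : √(r ^ 2 + 1 ^ 2) ^ 2 = r ^ 2 + 1 ^ 2 := Real.sq_sqrt (by positivity)
    have h1 := (((hasDerivAt_id r).pow 2).add_const ((1 : ℝ) ^ 2)).sqrt (by simp; positivity)
    have h2 := ((((hasDerivAt_id r).mul (h1.fun_inv (by simpa using hp.ne'))).pow 3).div_const 3)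
    refine HasDerivAt.congr_deriv h2 ?_
    simp
    simp only [one_pow] at hp hsq
    field_simp
    linear_combination r ^ 2 * hsq
  have hl : Tendsto (fun r : ℝ => (r * (√(r ^ 2 + 1 ^ 2))⁻¹) ^ 3 / 3) atTop (𝓝 (1 / 3)) := by
    have h : Tendsto (fun r : ℝ => (√(1 + r⁻¹ ^ 2))⁻¹) atTop (𝓝 1) := by
      have hc : ContinuousAt (fun t : ℝ => (√(1 + t ^ 2))⁻¹) 0 :=
        ContinuousAt.inv₀ (by fun_prop) (by simp)
      simpa [Function.comp_def] using hc.tendsto.comp tendsto_inv_atTop_zero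
    have h3 : Tendsto (fun r : ℝ => r * (√(r ^ 2 + 1 ^ 2))⁻¹) atTop (𝓝 1) := by
      refine h.congr' ?_
      filter_upwards [eventually_gt_atTop 0] with r hr
      rw [show r ^ 2 + 1 ^ 2 = r ^ 2 * (1 + r⁻¹ ^ 2) by field_simp, Real.sqrt_mul (by positivity),
        Real.sqrt_sq hr.le]
      field_simp
    simpa using (h3.pow 3).div_const 3
  have hi := integrableOn_Ioi_deriv_of_nonneg' hd (fun r _ => by positivity) hl
  simpa using integral_Ioi_of_hasDerivAt_of_tendsto' hd hi hl

section Kernels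

local notation "ℝ³" => EuclideanSpace ℝ (Fin 3)

namespace TemperedKernel

theorem of_norm_le_inv_norm {K : ℝ³ → ℂ} (hm : AEStronglyMeasurable K)
    (hK : ∀ z, ‖K z‖ ≤ ‖z‖⁻¹) : TemperedKernel volume K := by
  refine ⟨hm, 3, ?_⟩
  have hint : Integrable (fun z : ℝ³ => ‖z‖⁻¹ * ((1 + ‖z‖) ^ 3)⁻¹) := by
    rw [integrable_fun_norm_addHaar volume (f := fun r : ℝ => r⁻¹ * ((1 + r) ^ 3)⁻¹)]
    have hr : Integrable (fun r : ℝ => (1 + ‖r‖) ^ (-2 : ℝ)) :=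
      integrable_one_add_norm (by simp)
    refine hr.integrableOn.mono' (by fun_prop) ?_
    filter_upwards [ae_restrict_mem measurableSet_Ioi] with r (hr : 0 < r)
    have h1 : (1 + ‖r‖) ^ (-2 : ℝ) = ((1 + r) ^ 2)⁻¹ := by
      rw [Real.rpow_neg (by positivity), Real.norm_of_nonneg hr.le]
      norm_cast
    rw [h1, Real.norm_of_nonneg (by simp; positivity)]
    simp only [finrank_euclideanSpace, Fintype.card_fin, smul_eq_mul]
    rw [← sub_nonneg]
    have : ((1 + r) ^ 2)⁻¹ - r ^ (3 - 1) * (r⁻¹ * ((1 + r) ^ 3)⁻¹) = ((1 + r) ^ 3)⁻¹ := by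
      field_simp
      ring
    rw [this]
    positivity
  refine hint.mono' (hm.norm.mul (by fun_prop)) (Eventually.of_forall fun z => ?_)
  rw [Real.norm_of_nonneg (by positivity)]
  gcongr
  exact hK z

theorem of_norm_le_one_add_norm_sq {K : ℝ³ → ℂ} (hK : Continuous K) {C : ℝ}
    (hC : ∀ z, ‖K z‖ ≤ C * (1 + ‖z‖) ^ 2) : TemperedKernel volume K := by
  refine ⟨hK.aestronglyMeasurable, 6, ?_⟩
  have hint : Integrable (fun z : ℝ³ => (1 + ‖z‖) ^ (-4 : ℝ)) :=
    integrable_one_add_norm (by simp; norm_num)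
  refine (hint.const_mul C).mono' (hK.aestronglyMeasurable.norm.mul (by fun_prop))
    (Eventually.of_forall fun z => ?_)
  have h1 : (1 + ‖z‖) ^ (-4 : ℝ) = ((1 + ‖z‖) ^ 4)⁻¹ := by
    rw [Real.rpow_neg (by positivity)]
    norm_cast
  rw [Real.norm_of_nonneg (by positivity), h1, ← div_eq_mul_inv, ← div_eq_mul_inv,
    div_le_div_iff₀ (by positivity) (by positivity)]
  calc ‖K z‖ * (1 + ‖z‖) ^ 4 ≤ C * (1 + ‖z‖) ^ 2 * (1 + ‖z‖) ^ 4 := by gcongr; exact hC z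
    _ = _ := by ring

end TemperedKernel

/-- The regularized norm `√(‖z‖² + ε²)`. -/
noncomputable def regNorm (ε : ℝ) (z : ℝ³) : ℝ := √(‖z‖ ^ 2 + ε ^ 2)

theorem continuous_regNorm (ε : ℝ) : Continuous (regNorm ε) := by
  unfold regNorm
  fun_prop

theorem regNorm_sq (ε : ℝ) (z : ℝ³) : regNorm ε z ^ 2 = ‖z‖ ^ 2 + ε ^ 2 :=
  Real.sq_sqrt (by positivity)

theorem le_regNorm {ε : ℝ} (z : ℝ³) : ε ≤ regNorm ε z :=
  Real.le_sqrt_of_sq_le (by nlinarith [norm_nonneg z])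

theorem norm_le_regNorm (ε : ℝ) (z : ℝ³) : ‖z‖ ≤ regNorm ε z :=
  Real.le_sqrt_of_sq_le (by nlinarith)

theorem regNorm_smul {ε : ℝ} (hε : 0 ≤ ε) (w : ℝ³) : regNorm ε (ε • w) = ε * regNorm 1 w := by
  rw [regNorm, regNorm, norm_smul, Real.norm_of_nonneg hε,
    show (ε * ‖w‖) ^ 2 + ε ^ 2 = ε ^ 2 * (‖w‖ ^ 2 + 1 ^ 2) by ring, Real.sqrt_mul (by positivity),
    Real.sqrt_sq hε]

theorem tendsto_regNorm (z : ℝ³) : Tendsto (fun ε => regNorm ε z) (𝓝[>] 0) (𝓝 ‖z‖) := by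
  have : Continuous fun ε => regNorm ε z := by unfold regNorm; fun_prop
  simpa [regNorm] using (this.tendsto 0).mono_left nhdsWithin_le_nhds

/-- The derivative of a radial function of the regularized norm. -/
theorem hasLineDerivAt_comp_regNorm {ε : ℝ} (hε : 0 < ε) {a b : ℝ → ℂ}
    (hab : ∀ s, 0 < s → HasDerivAt a (b s * s) s) (z : ℝ³) (i : Fin 3) :
    HasLineDerivAt ℝ (fun z => a (regNorm ε z)) (b (regNorm ε z) * z i) z
      (EuclideanSpace.single i 1) := by
  have hpos : 0 < regNorm ε z := hε.trans_le (le_regNorm z)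
  have h1 : HasLineDerivAt ℝ (regNorm ε) (z i / regNorm ε z) z (EuclideanSpace.single i 1) := by
    have h := (((hasStrictFDerivAt_norm_sq z).hasFDerivAt.add_const (ε ^ 2)).sqrt
      (by positivity)).hasLineDerivAt (EuclideanSpace.single i 1)
    have hv : ((1 / (2 * √(‖z‖ ^ 2 + ε ^ 2))) • 2 • innerSL ℝ z) (EuclideanSpace.single i 1) =
        z i / regNorm ε z := by
      simp [regNorm, EuclideanSpace.inner_single_right]
      field_simp
    rwa [hv] at h
  have h2 := HasDerivAt.scomp (𝕜 := ℝ) (0 : ℝ) (h := fun t : ℝ => regNorm ε (z + t • EuclideanSpace.single i 1))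
    (g₁ := a) (g₁' := b (regNorm ε z) * regNorm ε z) (by simpa using hab _ hpos) h1
  refine HasDerivAt.congr_deriv h2 ?_
  simp only [Complex.real_smul]
  push_cast
  have : (regNorm ε z : ℂ) ≠ 0 := by exact_mod_cast hpos.ne'
  field_simp

theorem hasLineDerivAt_coord (z : ℝ³) (i : Fin 3) :
    HasLineDerivAt ℝ (fun z : ℝ³ => ((z i : ℝ) : ℂ)) 1 z (EuclideanSpace.single i 1) := by
  have h := (((hasDerivAt_id (0 : ℝ)).const_add (z i)).ofReal_comp)
  unfold HasLineDerivAt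
  simpa using h


theorem integral_regNorm_inv_pow : ∫ w : ℝ³, (regNorm 1 w)⁻¹ ^ 5 = 4 * Real.pi / 3 := by
  have h := integral_fun_norm_addHaar (volume : Measure ℝ³)
    (fun r : ℝ => (√(r ^ 2 + 1 ^ 2))⁻¹ ^ 5)
  have hb : (volume : Measure ℝ³).real (Metric.ball 0 1) = Real.pi * 4 / 3 := by
    rw [measureReal_def, EuclideanSpace.volume_ball_fin_three]
    simp
    positivity
  simp only [finrank_euclideanSpace, Fintype.card_fin, smul_eq_mul, hb, Nat.add_one_sub_one,
    integral_Ioi_sq_mul_inv_sqrt_pow, nsmul_eq_mul] at h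
  unfold regNorm
  rw [h]
  push_cast
  ring

theorem integrable_regNorm_inv_pow : Integrable (fun w : ℝ³ => (regNorm 1 w)⁻¹ ^ 4) := by
  refine (integrable_rpow_neg_one_add_norm_sq (r := 4) (by simp; norm_num)).congr
    (Eventually.of_forall fun w => ?_)
  have h : (regNorm 1 w) ^ 4 = (1 + ‖w‖ ^ 2) ^ 2 := by
    rw [show (regNorm 1 w) ^ 4 = ((regNorm 1 w) ^ 2) ^ 2 by ring, regNorm_sq]
    ring
  dsimp only
  rw [inv_pow, h, show (-4 / 2 : ℝ) = -2 by norm_num, Real.rpow_neg (by positivity)]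
  norm_cast

section Regularized

variable {lam : ℂ} {ε : ℝ}

theorem continuous_comp_regNorm {a : ℝ → ℂ} (hε : 0 < ε) (ha : ∀ s, 0 < s → ContinuousAt a s) :
    Continuous fun z => a (regNorm ε z) :=
  continuous_iff_continuousAt.2 fun z =>
    (ha _ (hε.trans_le (le_regNorm z))).comp (continuous_regNorm ε).continuousAt

theorem inv_regNorm_le (hε : 0 < ε) (z : ℝ³) : (regNorm ε z)⁻¹ ≤ ε⁻¹ :=
  inv_anti₀ hε (le_regNorm z)

theorem regNorm_pos (hε : 0 < ε) (z : ℝ³) : 0 < regNorm ε z := hε.trans_le (le_regNorm z)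

theorem norm_coord_le (z : ℝ³) (i : Fin 3) : ‖((z i : ℝ) : ℂ)‖ ≤ 1 + ‖z‖ := by
  rw [Complex.norm_real]
  linarith [PiLp.norm_apply_le z i]

theorem exists_norm_helmholtzProfileDeriv_regNorm_le (hlam : 0 ≤ lam.im) (hε : 0 < ε) :
    ∃ C, 0 ≤ C ∧ ∀ z : ℝ³, ‖helmholtzProfileDeriv lam (regNorm ε z)‖ ≤ C := by
  refine ⟨‖lam‖ * ε⁻¹ ^ 2 + ε⁻¹ ^ 3, by positivity, fun z => ?_⟩
  have hp := regNorm_pos hε z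
  have hi := inv_regNorm_le hε z
  refine (norm_helmholtzProfileDeriv_le hlam hp.le).trans ?_
  gcongr

theorem exists_norm_helmholtzProfileDeriv₂_regNorm_le (hlam : 0 ≤ lam.im) (hε : 0 < ε) :
    ∃ C, 0 ≤ C ∧ ∀ z : ℝ³, ‖helmholtzProfileDeriv₂ lam (regNorm ε z)‖ ≤ C := by
  refine ⟨‖lam‖ ^ 2 * ε⁻¹ ^ 3 + 3 * ‖lam‖ * ε⁻¹ ^ 4 + 3 * ε⁻¹ ^ 5, by positivity, fun z => ?_⟩
  have hp := regNorm_pos hε z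
  have hi := inv_regNorm_le hε z
  refine (norm_helmholtzProfileDeriv₂_le hlam hp.le).trans ?_
  gcongr

theorem temperedKernel_helmholtzProfile_regNorm (hlam : 0 ≤ lam.im) (hε : 0 < ε) :
    TemperedKernel (volume : Measure ℝ³) (fun z => helmholtzProfile lam (regNorm ε z)) := by
  refine .of_norm_le_one_add_norm_sq (C := ε⁻¹)
    (continuous_comp_regNorm hε fun s => continuousAt_helmholtzProfile) fun z => ?_
  calc _ ≤ ε⁻¹ := (norm_helmholtzProfile_le hlam (regNorm_pos hε z).le).trans (inv_regNorm_le hε z)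
    _ ≤ ε⁻¹ * (1 + ‖z‖) ^ 2 :=
      le_mul_of_one_le_right (by positivity) (by nlinarith [norm_nonneg z])

theorem temperedKernel_helmholtzProfileDeriv_regNorm (hlam : 0 ≤ lam.im) (hε : 0 < ε) (i : Fin 3) :
    TemperedKernel (volume : Measure ℝ³)
      (fun z => helmholtzProfileDeriv lam (regNorm ε z) * (z i : ℝ)) := by
  obtain ⟨C, hC0, hC⟩ := exists_norm_helmholtzProfileDeriv_regNorm_le hlam hε
  refine .of_norm_le_one_add_norm_sq (C := C)
    ((continuous_comp_regNorm hε fun s => continuousAt_helmholtzProfileDeriv).mul (by fun_prop))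
    fun z => ?_
  rw [norm_mul]
  calc _ ≤ C * (1 + ‖z‖) := by gcongr; exacts [hC z, norm_coord_le z i]
    _ ≤ C * (1 + ‖z‖) ^ 2 := by gcongr; nlinarith [norm_nonneg z]

theorem temperedKernel_helmholtzProfileDeriv₂_regNorm (hlam : 0 ≤ lam.im) (hε : 0 < ε)
    (i : Fin 3) :
    TemperedKernel (volume : Measure ℝ³)
      (fun z => helmholtzProfileDeriv₂ lam (regNorm ε z) * (z i : ℝ) * (z i : ℝ)
        + helmholtzProfileDeriv lam (regNorm ε z)) := by
  obtain ⟨C, hC0, hC⟩ := exists_norm_helmholtzProfileDeriv_regNorm_le hlam hε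
  obtain ⟨D, hD0, hD⟩ := exists_norm_helmholtzProfileDeriv₂_regNorm_le hlam hε
  refine .of_norm_le_one_add_norm_sq (C := D + C)
    ((((continuous_comp_regNorm hε fun s => continuousAt_helmholtzProfileDeriv₂).mul
      (by fun_prop)).mul (by fun_prop)).add
      (continuous_comp_regNorm hε fun s => continuousAt_helmholtzProfileDeriv))
    fun z => ?_
  refine (norm_add_le _ _).trans ?_
  rw [norm_mul, norm_mul]
  calc _ ≤ D * (1 + ‖z‖) * (1 + ‖z‖) + C := by
        gcongr; exacts [hD z, norm_coord_le z i, norm_coord_le z i, hC z]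
    _ ≤ _ := by nlinarith [norm_nonneg z, mul_nonneg hC0 (norm_nonneg z)]

/-- The operator `Δ + λ²` on Schwartz functions. -/
noncomputable def schwartzHelmholtz (lam : ℂ) (f : 𝓢(ℝ³, ℂ)) : 𝓢(ℝ³, ℂ) :=
  ∑ i : Fin 3, ∂_{EuclideanSpace.single i (1 : ℝ)} (∂_{EuclideanSpace.single i (1 : ℝ)} f)
    + lam ^ 2 • f

theorem TemperedKernel.integral_schwartzHelmholtz {K : ℝ³ → ℂ} (hK : TemperedKernel volume K)
    (f : 𝓢(ℝ³, ℂ)) (x : ℝ³) :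
    ∫ z, K z • schwartzHelmholtz lam f (x - z) =
      ∑ i : Fin 3, (∫ z, K z • (∂_{EuclideanSpace.single i (1 : ℝ)}
        (∂_{EuclideanSpace.single i (1 : ℝ)} f) : 𝓢(ℝ³, ℂ)) (x - z))
      + lam ^ 2 * ∫ z, K z • f (x - z) := by
  rw [← integral_const_mul, ← integral_finsetSum _ fun i _ => hK.integrable_smul _ x,
    ← integral_add (integrable_finsetSum _ fun i _ => hK.integrable_smul _ x)
      ((hK.integrable_smul f x).const_mul _)]
  refine integral_congr_ae (Eventually.of_forall fun z => ?_)
  simp only [schwartzHelmholtz, add_apply, sum_apply, smul_apply,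
    smul_eq_mul, mul_add, Finset.mul_sum]
  ring

theorem integral_regularized_schwartzHelmholtz (hlam : 0 ≤ lam.im) (hε : 0 < ε)
    (f : 𝓢(ℝ³, ℂ)) (x : ℝ³) :
    ∫ z, helmholtzProfile lam (regNorm ε z) • schwartzHelmholtz lam f (x - z) =
      ∫ z, (-(ε : ℂ) ^ 2 * helmholtzProfileDeriv₂ lam (regNorm ε z)) • f (x - z) := by
  have h0 := temperedKernel_helmholtzProfile_regNorm hlam hε
  have h1 := temperedKernel_helmholtzProfileDeriv_regNorm hlam hε
  have h2 := temperedKernel_helmholtzProfileDeriv₂_regNorm hlam hε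
  have hd1 (i : Fin 3) (z : ℝ³) := hasLineDerivAt_comp_regNorm hε
    (fun s hs => hasDerivAt_helmholtzProfile (lam := lam) hs) z i
  have hd2 (i : Fin 3) (z : ℝ³) : HasLineDerivAt ℝ
      (fun z : ℝ³ => helmholtzProfileDeriv lam (regNorm ε z) * (z i : ℝ))
      (helmholtzProfileDeriv₂ lam (regNorm ε z) * (z i : ℝ) * (z i : ℝ)
        + helmholtzProfileDeriv lam (regNorm ε z)) z (EuclideanSpace.single i 1) := by
    have h := HasDerivAt.mul (hasLineDerivAt_comp_regNorm hε
      (fun s hs => hasDerivAt_helmholtzProfileDeriv (lam := lam) hs) z i) (hasLineDerivAt_coord z i)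
    refine HasDerivAt.congr_deriv h ?_
    simp
  rw [h0.integral_schwartzHelmholtz]
  simp_rw [h0.integral_smul_lineDeriv (h1 _) (hd1 _),
    (h1 _).integral_smul_lineDeriv (h2 _) (hd2 _)]
  rw [← integral_const_mul, ← integral_finsetSum _ fun i _ => (h2 i).integrable_smul _ x,
    ← integral_add (integrable_finsetSum _ fun i _ => (h2 i).integrable_smul _ x)
      ((h0.integrable_smul f x).const_mul _)]
  refine integral_congr_ae (Eventually.of_forall fun z => ?_)
  have hode := helmholtzProfile_ode (lam := lam) (regNorm_pos hε z)
  have hsq : (regNorm ε z : ℂ) ^ 2 =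
      ((z 0 : ℝ) : ℂ) ^ 2 + ((z 1 : ℝ) : ℂ) ^ 2 + ((z 2 : ℝ) : ℂ) ^ 2 + (ε : ℂ) ^ 2 := by
    have := regNorm_sq ε z
    rw [EuclideanSpace.norm_sq_eq, Fin.sum_univ_three] at this
    simp only [Real.norm_eq_abs, sq_abs] at this
    exact_mod_cast this
  simp only [Fin.sum_univ_three, smul_eq_mul]
  rw [hsq] at hode
  linear_combination f (x - z) * hode

theorem temperedKernel_helmholtzProfile_norm (hlam : 0 ≤ lam.im) :
    TemperedKernel (volume : Measure ℝ³) (fun z => helmholtzProfile lam ‖z‖) := by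
  refine .of_norm_le_inv_norm ?_ fun z => norm_helmholtzProfile_le hlam (norm_nonneg z)
  have : Measurable fun z : ℝ³ => Complex.exp (Complex.I * lam * ‖z‖) * (‖z‖ : ℂ)⁻¹ := by fun_prop
  exact this.aestronglyMeasurable

theorem tendsto_integral_helmholtzProfile_regNorm (hlam : 0 ≤ lam.im) (g : 𝓢(ℝ³, ℂ)) (x : ℝ³) :
    Tendsto (fun ε => ∫ z, helmholtzProfile lam (regNorm ε z) • g (x - z)) (𝓝[>] 0)
      (𝓝 (∫ z, helmholtzProfile lam ‖z‖ • g (x - z))) := by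
  have hinv : TemperedKernel (volume : Measure ℝ³) (fun z => (‖z‖ : ℂ)⁻¹) :=
    .of_norm_le_inv_norm (by fun_prop) (by simp)
  have hne : ∀ᵐ z : ℝ³, z ≠ 0 := by simp [ae_iff]
  refine tendsto_integral_filter_of_dominated_convergence _ ?_ ?_ (hinv.integrable_smul g x).norm ?_
  · filter_upwards [self_mem_nhdsWithin] with ε hε
    exact (temperedKernel_helmholtzProfile_regNorm hlam hε).aestronglyMeasurable_smul g x
  · filter_upwards [self_mem_nhdsWithin] with ε (hε : 0 < ε)
    filter_upwards [hne] with z hz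
    have hz' : 0 < ‖z‖ := norm_pos_iff.2 hz
    rw [norm_smul, norm_smul, norm_inv, Complex.norm_real, norm_norm]
    gcongr
    exact (norm_helmholtzProfile_le hlam (regNorm_pos hε z).le).trans
      (inv_anti₀ hz' (norm_le_regNorm ε z))
  · filter_upwards [hne] with z hz
    exact ((continuousAt_helmholtzProfile (norm_pos_iff.2 hz)).tendsto.comp
      (tendsto_regNorm z)).smul_const _

theorem integral_helmholtzProfileDeriv₂_rescale (hε : 0 < ε) (f : ℝ³ → ℂ) (x : ℝ³) :
    ∫ z, (-(ε : ℂ) ^ 2 * helmholtzProfileDeriv₂ lam (regNorm ε z)) • f (x - z) =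
      ∫ w, (-(ε : ℂ) ^ 5 * helmholtzProfileDeriv₂ lam (ε * regNorm 1 w)) • f (x - ε • w) := by
  have h := Measure.integral_comp_smul (volume : Measure ℝ³)
    (fun z => (-(ε : ℂ) ^ 2 * helmholtzProfileDeriv₂ lam (regNorm ε z)) • f (x - z)) ε
  simp only [regNorm_smul hε.le, finrank_euclideanSpace, Fintype.card_fin] at h
  have hε' : (ε : ℂ) ≠ 0 := by exact_mod_cast hε.ne'
  have h3 : ∫ w, (-(ε : ℂ) ^ 5 * helmholtzProfileDeriv₂ lam (ε * regNorm 1 w)) • f (x - ε • w) =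
      (ε : ℂ) ^ 3 * ∫ w, (-(ε : ℂ) ^ 2 * helmholtzProfileDeriv₂ lam (ε * regNorm 1 w)) •
        f (x - ε • w) := by
    rw [← integral_const_mul]
    refine integral_congr_ae (Eventually.of_forall fun w => ?_)
    simp only [smul_eq_mul]
    ring
  rw [h3, h, abs_of_pos (by positivity), Complex.real_smul]
  push_cast
  field_simp

theorem pow_mul_helmholtzProfileDeriv₂ (hε : 0 < ε) {s : ℝ} (hs : 0 < s) :
    -(ε : ℂ) ^ 5 * helmholtzProfileDeriv₂ lam (ε * s) =
      -(Complex.exp (Complex.I * lam * (ε * s)) * (-lam ^ 2 * ε ^ 2 * (s : ℂ)⁻¹ ^ 3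
        - 3 * Complex.I * lam * ε * (s : ℂ)⁻¹ ^ 4 + 3 * (s : ℂ)⁻¹ ^ 5)) := by
  have hε' : (ε : ℂ) ≠ 0 := by exact_mod_cast hε.ne'
  have hs' : (s : ℂ) ≠ 0 := by exact_mod_cast hs.ne'
  simp only [helmholtzProfileDeriv₂]
  push_cast
  field_simp

theorem norm_pow_mul_helmholtzProfileDeriv₂_le (hlam : 0 ≤ lam.im) (hε : 0 < ε) {s : ℝ}
    (hs : 0 < s) :
    ‖-(ε : ℂ) ^ 5 * helmholtzProfileDeriv₂ lam (ε * s)‖ ≤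
      ‖lam‖ ^ 2 * ε ^ 2 * s⁻¹ ^ 3 + 3 * ‖lam‖ * ε * s⁻¹ ^ 4 + 3 * s⁻¹ ^ 5 := by
  rw [norm_mul, norm_neg, norm_pow, Complex.norm_of_nonneg hε.le]
  calc _ ≤ ε ^ 5 * (‖lam‖ ^ 2 * (ε * s)⁻¹ ^ 3 + 3 * ‖lam‖ * (ε * s)⁻¹ ^ 4 + 3 * (ε * s)⁻¹ ^ 5) := by
        gcongr
        exact norm_helmholtzProfileDeriv₂_le hlam (by positivity)
    _ = _ := by field_simp

theorem norm_rescaled_integrand_le (hlam : 0 ≤ lam.im) (hε : 0 < ε) (hε1 : ε ≤ 1) {C : ℝ}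
    {w : ℝ³} {c : ℂ} (hc : ‖c‖ ≤ C * ((1 + ‖ε • w‖) ^ 1)⁻¹) :
    ‖(-(ε : ℂ) ^ 5 * helmholtzProfileDeriv₂ lam (ε * regNorm 1 w)) • c‖ ≤
      C * (‖lam‖ ^ 2 + 3 * ‖lam‖ + 3) * (regNorm 1 w)⁻¹ ^ 4 := by
  set s := regNorm 1 w
  have hs : 1 ≤ s := le_regNorm w
  have hs0 : 0 < s := one_pos.trans_le hs
  have hsw : s ≤ 1 + ‖w‖ := by
    refine Real.sqrt_le_iff.2 ⟨by positivity, by nlinarith [norm_nonneg w]⟩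
  rw [norm_smul ε w, Real.norm_of_nonneg hε.le, pow_one, ← div_eq_mul_inv,
    le_div_iff₀ (by positivity)] at hc
  have h1 : ‖c‖ ≤ C := le_trans (le_mul_of_one_le_right (norm_nonneg c)
    (by linarith [mul_nonneg hε.le (norm_nonneg w)])) hc
  have h2 : ε * s * ‖c‖ ≤ C := by
    refine le_trans ?_ hc
    rw [mul_comm]
    gcongr
    nlinarith
  have hC : 0 ≤ C := (norm_nonneg c).trans h1
  have hi : s⁻¹ ≤ 1 := inv_le_one_of_one_le₀ hs
  rw [norm_smul]
  calc _ ≤ (‖lam‖ ^ 2 * ε ^ 2 * s⁻¹ ^ 3 + 3 * ‖lam‖ * ε * s⁻¹ ^ 4 + 3 * s⁻¹ ^ 5) * ‖c‖ := by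
        gcongr
        exact norm_pow_mul_helmholtzProfileDeriv₂_le hlam hε hs0
    _ = ‖lam‖ ^ 2 * s⁻¹ ^ 4 * ε * (ε * s * ‖c‖) + 3 * ‖lam‖ * s⁻¹ ^ 4 * ε * ‖c‖
        + 3 * s⁻¹ ^ 4 * s⁻¹ * ‖c‖ := by field_simp
    _ ≤ ‖lam‖ ^ 2 * s⁻¹ ^ 4 * 1 * C + 3 * ‖lam‖ * s⁻¹ ^ 4 * 1 * C
        + 3 * s⁻¹ ^ 4 * 1 * C := by gcongr
    _ = _ := by ring

/-- The error terms of the regularization form an approximate identity. -/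
theorem tendsto_integral_helmholtzProfileDeriv₂_regNorm (hlam : 0 ≤ lam.im) (f : 𝓢(ℝ³, ℂ))
    (x : ℝ³) :
    Tendsto (fun ε : ℝ => ∫ z, (-(ε : ℂ) ^ 2 * helmholtzProfileDeriv₂ lam (regNorm ε z)) •
      f (x - z)) (𝓝[>] 0) (𝓝 (-(4 * Real.pi * f x))) := by
  have hlim : ∫ w : ℝ³, -(3 * f x) * (((regNorm 1 w)⁻¹ ^ 5 : ℝ) : ℂ) = -(4 * Real.pi * f x) := by
    rw [integral_const_mul, integral_complex_ofReal, integral_regNorm_inv_pow]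
    push_cast
    ring
  rw [← hlim]
  have hcongr : (fun ε : ℝ => ∫ w, (-(ε : ℂ) ^ 5 * helmholtzProfileDeriv₂ lam (ε * regNorm 1 w)) •
      f (x - ε • w)) =ᶠ[𝓝[>] 0] fun ε : ℝ => ∫ z,
        (-(ε : ℂ) ^ 2 * helmholtzProfileDeriv₂ lam (regNorm ε z)) • f (x - z) := by
    filter_upwards [self_mem_nhdsWithin] with ε hε
    exact (integral_helmholtzProfileDeriv₂_rescale hε f x).symm
  refine Tendsto.congr' hcongr ?_
  obtain ⟨C, -, hC⟩ := f.exists_norm_sub_le x 1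
  refine tendsto_integral_filter_of_dominated_convergence _ ?_ ?_
    (integrable_regNorm_inv_pow.const_mul (C * (‖lam‖ ^ 2 + 3 * ‖lam‖ + 3))) ?_
  · filter_upwards [self_mem_nhdsWithin] with ε (hε : 0 < ε)
    have hc : Continuous fun w : ℝ³ => helmholtzProfileDeriv₂ lam (ε * regNorm 1 w) :=
      continuous_iff_continuousAt.2 fun w =>
        (continuousAt_helmholtzProfileDeriv₂ (mul_pos hε (regNorm_pos one_pos w))).comp
          (f := fun w => ε * regNorm 1 w) ((continuous_regNorm 1).const_mul ε).continuousAt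
    exact ((continuous_const.mul hc).smul
      (f.continuous.comp (by fun_prop))).aestronglyMeasurable
  · filter_upwards [Ioc_mem_nhdsGT one_pos] with ε hε
    exact Eventually.of_forall fun w => norm_rescaled_integrand_le hlam hε.1 hε.2
      (hC x (Metric.mem_ball_self one_pos) _)
  · refine Eventually.of_forall fun w => ?_
    have hs := regNorm_pos one_pos w
    have hc : Continuous fun ε : ℝ => -(Complex.exp (Complex.I * lam * (ε * regNorm 1 w)) *
        (-lam ^ 2 * ε ^ 2 * (regNorm 1 w : ℂ)⁻¹ ^ 3 - 3 * Complex.I * lam * ε *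
          (regNorm 1 w : ℂ)⁻¹ ^ 4 + 3 * (regNorm 1 w : ℂ)⁻¹ ^ 5)) • f (x - ε • w) := by
      have := f.continuous
      fun_prop
    have ht := (hc.tendsto 0).mono_left (nhdsWithin_le_nhds (s := Set.Ioi 0))
    refine (ht.congr' ?_).trans_eq ?_
    · filter_upwards [self_mem_nhdsWithin] with ε hε
      rw [pow_mul_helmholtzProfileDeriv₂ hε hs]
    · congr 1
      simp
      ring

end Regularized

/-- The kernel `e^{iλ‖z‖}/‖z‖` is `-4π` times a fundamental solution of `Δ + λ²`. -/
theorem integral_helmholtzProfile_schwartzHelmholtz {lam : ℂ} (hlam : 0 ≤ lam.im) (f : 𝓢(ℝ³, ℂ))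
    (x : ℝ³) :
    ∫ z, helmholtzProfile lam ‖z‖ • schwartzHelmholtz lam f (x - z) = -(4 * Real.pi * f x) := by
  refine tendsto_nhds_unique (tendsto_integral_helmholtzProfile_regNorm hlam _ x)
    ((tendsto_integral_helmholtzProfileDeriv₂_regNorm hlam f x).congr' ?_)
  filter_upwards [self_mem_nhdsWithin] with ε hε
  exact (integral_regularized_schwartzHelmholtz hlam hε f x).symm

theorem TemperedKernel.const_mul {K : ℝ³ → ℂ} (hK : TemperedKernel volume K) (c : ℂ) :
    TemperedKernel volume (fun z => c * K z) := by
  obtain ⟨hm, k, hk⟩ := hK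
  refine ⟨hm.const_mul c, k, (hk.const_mul ‖c‖).congr (Eventually.of_forall fun z => ?_)⟩
  simp only [norm_mul]
  ring

theorem lapC_integral_smul {K : ℝ³ → ℂ} (hK : TemperedKernel volume K) (f : 𝓢(ℝ³, ℂ)) (x : ℝ³) :
    lapC (fun x => ∫ z, K z • f (x - z)) x =
      ∑ i : Fin 3, (∫ z, K z • (∂_{EuclideanSpace.single i (1 : ℝ)}
        (∂_{EuclideanSpace.single i (1 : ℝ)} f) : 𝓢(ℝ³, ℂ)) (x - z)) := by
  simp only [lapC, hK.fderiv_integral_apply]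

end Kernels

/-- The free resolvent `R₀(λ²) = (−Δ − λ²)⁻¹` with the outgoing boundary condition has
integral kernel `e^{iλ‖x−y‖}/(4π‖x−y‖)`: for `Im λ ≥ 0` and Schwartz `f`, the function
`u(x) = ∫ e^{iλ‖x−y‖}/(4π‖x−y‖) f(y) dy` is twice continuously differentiable and satisfies
`−Δu − λ²u = f` on `ℝ³`. -/
theorem stmt_13 (lam : ℂ) (hlam : 0 ≤ lam.im)
    (f : SchwartzMap (EuclideanSpace ℝ (Fin 3)) ℂ)
    (u : EuclideanSpace ℝ (Fin 3) → ℂ)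
    (hu : ∀ x : EuclideanSpace ℝ (Fin 3),
      u x = ∫ y : EuclideanSpace ℝ (Fin 3),
        (Complex.exp (Complex.I * lam * (‖x - y‖ : ℂ)) / ((4 * Real.pi * ‖x - y‖ : ℝ) : ℂ))
          * f y) :
    ContDiff ℝ 2 u ∧
      ∀ x : EuclideanSpace ℝ (Fin 3), -lapC u x - lam ^ 2 * u x = f x := by
  set K : EuclideanSpace ℝ (Fin 3) → ℂ := fun z => (4 * Real.pi : ℂ)⁻¹ * helmholtzProfile lam ‖z‖
  have hK : TemperedKernel volume K := (temperedKernel_helmholtzProfile_norm hlam).const_mul _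
  have huK : u = fun x => ∫ z, K z • f (x - z) := by
    ext x
    rw [hu, ← integral_sub_left_eq_self _ volume x]
    refine integral_congr_ae (Filter.Eventually.of_forall fun z => ?_)
    simp only [K, helmholtzProfile, sub_sub_cancel, smul_eq_mul]
    push_cast
    rw [div_eq_mul_inv, mul_inv]
    ring
  rw [huK]
  refine ⟨hK.contDiff_two_integral f, fun x => ?_⟩
  have h := hK.integral_schwartzHelmholtz (lam := lam) f x
  have hval : ∫ z, K z • schwartzHelmholtz lam f (x - z) = -f x := by
    simp only [K, smul_eq_mul, mul_assoc, integral_const_mul]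
    have := integral_helmholtzProfile_schwartzHelmholtz hlam f x
    simp only [smul_eq_mul] at this
    rw [this]
    have hpi : (Real.pi : ℂ) ≠ 0 := by exact_mod_cast Real.pi_ne_zero
    field_simp
  rw [hval] at h
  rw [lapC_integral_smul hK]
  linear_combination h
end

section
/- There exists a constant C > 0 such that for all a ∈ [1/2, 2] and all x ∈ ℝ³, |ψₐ(x) − a^{−5/4} ψ₁(x)| ≤ C |a − 1| (1 + ‖x‖)^{−3}, where ψₐ(x) = (3^{1/4}/4) a^{−3/4} (1 − a‖x‖²)(1 + a‖x‖²)^{−3/2}. -/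
/-- `ψₐ(x) = (3^{1/4}/4) a^{−3/4} (1 − a‖x‖²)(1 + a‖x‖²)^{−3/2}`, the derivative `∂ₐφₐ`
of the soliton `φₐ` in the scaling parameter. -/
noncomputable def dsoliton (a : ℝ) (x : EuclideanSpace ℝ (Fin 3)) : ℝ :=
  ((3 : ℝ) ^ ((1 : ℝ) / 4) / 4) * a ^ (-(3 : ℝ) / 4) * (1 - a * ‖x‖ ^ 2) *
    (1 + a * ‖x‖ ^ 2) ^ (-(3 : ℝ) / 2)

/-- The profile `(b - s) (b + s)^{-3/2}` has derivative of size `(b + s)^{-3/2}` in `b`. -/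
lemma hasDerivAt_sub_mul_add_rpow {b s : ℝ} (h : 0 < b + s) :
    HasDerivAt (fun b : ℝ => (b - s) * (b + s) ^ (-(3 : ℝ) / 2))
      ((5 / 2 * s - 1 / 2 * b) / (b + s) * (b + s) ^ (-(3 : ℝ) / 2)) b := by
  have h1 : HasDerivAt (fun b : ℝ => b - s) 1 b := (hasDerivAt_id b).sub_const s
  have h2 : HasDerivAt (fun b : ℝ => b + s) 1 b := (hasDerivAt_id b).add_const s
  refine (h1.fun_mul (h2.rpow_const (p := -(3 : ℝ) / 2) (Or.inl h.ne'))).congr_deriv ?_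
  rw [Real.rpow_sub_one h.ne']
  field_simp
  ring

lemma add_sq_rpow_le {b r : ℝ} (hb : 1 / 2 ≤ b) (hr : 0 ≤ r) :
    (b + r ^ 2) ^ (-(3 : ℝ) / 2) ≤ 8 / (1 + r) ^ 3 := by
  have hpos : 0 < (1 + r) / 2 := by positivity
  calc (b + r ^ 2) ^ (-(3 : ℝ) / 2) ≤ (((1 + r) / 2) ^ 2) ^ (-(3 : ℝ) / 2) :=
        Real.rpow_le_rpow_of_nonpos (by positivity) (by nlinarith [sq_nonneg (r - 1)])
          (by norm_num)
    _ = 8 / (1 + r) ^ 3 := by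
        rw [← Real.rpow_natCast, ← Real.rpow_mul hpos.le,
          show ((2 : ℕ) : ℝ) * (-(3 : ℝ) / 2) = -((3 : ℕ) : ℝ) by norm_num,
          Real.rpow_neg hpos.le, Real.rpow_natCast]
        field_simp
        norm_num

lemma abs_sub_mul_add_sq_rpow_sub_le {b r : ℝ} (hb : 1 / 2 ≤ b) (hr : 0 ≤ r) :
    |(b - r ^ 2) * (b + r ^ 2) ^ (-(3 : ℝ) / 2) - (1 - r ^ 2) * (1 + r ^ 2) ^ (-(3 : ℝ) / 2)|
      ≤ 20 / (1 + r) ^ 3 * |b - 1| := by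
  refine (convex_Ici (1 / 2 : ℝ)).norm_image_sub_le_of_norm_hasDerivWithin_le
    (f := fun b : ℝ => (b - r ^ 2) * (b + r ^ 2) ^ (-(3 : ℝ) / 2)) (C := 20 / (1 + r) ^ 3)
    (fun t ht => (hasDerivAt_sub_mul_add_rpow ?_).hasDerivWithinAt)
    (fun t ht => ?_) (by norm_num : (1 : ℝ) ∈ Set.Ici (1 / 2)) hb
  · have : (1 / 2 : ℝ) ≤ t := ht
    positivity
  · have ht' : (1 / 2 : ℝ) ≤ t := ht
    have hpos : 0 < t + r ^ 2 := by positivity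
    have hquot : |(5 / 2 * r ^ 2 - 1 / 2 * t) / (t + r ^ 2)| ≤ 5 / 2 := by
      rw [abs_div, abs_of_pos hpos, div_le_iff₀ hpos, abs_le]
      constructor <;> nlinarith [sq_nonneg r]
    rw [Real.norm_eq_abs, abs_mul, abs_of_nonneg (Real.rpow_nonneg hpos.le _)]
    calc _ ≤ 5 / 2 * (8 / (1 + r) ^ 3) :=
          mul_le_mul hquot (add_sq_rpow_le ht' hr) (Real.rpow_nonneg hpos.le _) (by norm_num)
      _ = 20 / (1 + r) ^ 3 := by ring

lemma dsoliton_eq_inv {a : ℝ} (ha : 0 < a) (x : EuclideanSpace ℝ (Fin 3)) :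
    dsoliton a x = ((3 : ℝ) ^ ((1 : ℝ) / 4) / 4) * a ^ (-(5 : ℝ) / 4) *
      ((a⁻¹ - ‖x‖ ^ 2) * (a⁻¹ + ‖x‖ ^ 2) ^ (-(3 : ℝ) / 2)) := by
  have h1 : 1 + a * ‖x‖ ^ 2 = a * (a⁻¹ + ‖x‖ ^ 2) := by field_simp
  have h2 : 1 - a * ‖x‖ ^ 2 = a * (a⁻¹ - ‖x‖ ^ 2) := by field_simp
  have h3 : a ^ (-(3 : ℝ) / 4) * a * a ^ (-(3 : ℝ) / 2) = a ^ (-(5 : ℝ) / 4) := by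
    rw [← Real.rpow_add_one ha.ne', ← Real.rpow_add ha]
    norm_num
  rw [dsoliton, h1, h2, Real.mul_rpow ha.le (by positivity), ← h3]
  ring

/-- There is `C > 0` such that for `a ∈ [1/2, 2]` and `x ∈ ℝ³`,
`|ψₐ(x) − a^{−5/4} ψ₁(x)| ≤ C |a − 1| (1 + ‖x‖)^{−3}`: the `‖x‖^{−1}` leading terms of
`ψₐ` and `a^{−5/4}ψ₁` cancel. -/
theorem stmt_16 :
    ∃ C : ℝ, 0 < C ∧ ∀ a ∈ Set.Icc (1 / 2 : ℝ) 2, ∀ x : EuclideanSpace ℝ (Fin 3),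
      |dsoliton a x - a ^ (-(5 : ℝ) / 4) * dsoliton 1 x| ≤ C * |a - 1| / (1 + ‖x‖) ^ 3 := by
  refine ⟨160, by norm_num, fun a ⟨ha1, ha2⟩ x => ?_⟩
  have ha : 0 < a := by linarith
  have hc : (3 : ℝ) ^ ((1 : ℝ) / 4) / 4 ≤ 1 := by
    have := Real.rpow_le_rpow_of_exponent_le (by norm_num : (1 : ℝ) ≤ 3)
      (by norm_num : (1 : ℝ) / 4 ≤ 1)
    rw [Real.rpow_one] at this
    linarith
  have hpow : a ^ (-(5 : ℝ) / 4) ≤ 4 :=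
    calc a ^ (-(5 : ℝ) / 4) ≤ (1 / 2 : ℝ) ^ (-(5 : ℝ) / 4) :=
          Real.rpow_le_rpow_of_nonpos (by norm_num) ha1 (by norm_num)
      _ ≤ (1 / 2 : ℝ) ^ (-(2 : ℝ)) :=
          Real.rpow_le_rpow_of_exponent_ge (by norm_num) (by norm_num) (by norm_num)
      _ = 4 := by
          rw [Real.rpow_neg (by norm_num), Real.rpow_two]
          norm_num
  have hinv : |a⁻¹ - 1| ≤ 2 * |a - 1| := by
    rw [show a⁻¹ - 1 = a⁻¹ * (1 - a) by field_simp, abs_mul, abs_of_pos (inv_pos.2 ha),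
      abs_sub_comm 1 a]
    gcongr
    rw [inv_le_comm₀ ha two_pos]
    linarith
  have hhalf : 1 / 2 ≤ a⁻¹ := by
    rw [one_div]
    exact inv_anti₀ ha ha2
  rw [dsoliton_eq_inv ha, dsoliton_eq_inv one_pos, inv_one, Real.one_rpow]
  set G := (a⁻¹ - ‖x‖ ^ 2) * (a⁻¹ + ‖x‖ ^ 2) ^ (-(3 : ℝ) / 2)
  set G₁ := (1 - ‖x‖ ^ 2) * (1 + ‖x‖ ^ 2) ^ (-(3 : ℝ) / 2)
  have hG : |G - G₁| ≤ 20 / (1 + ‖x‖) ^ 3 * |a⁻¹ - 1| :=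
    abs_sub_mul_add_sq_rpow_sub_le hhalf (norm_nonneg x)
  set c := (3 : ℝ) ^ ((1 : ℝ) / 4) / 4
  have hc0 : 0 ≤ c := by positivity
  calc |c * a ^ (-(5 : ℝ) / 4) * G - a ^ (-(5 : ℝ) / 4) * (c * 1 * G₁)|
      = c * a ^ (-(5 : ℝ) / 4) * |G - G₁| := by
        rw [← abs_of_nonneg (by positivity : 0 ≤ c * a ^ (-(5 : ℝ) / 4)), ← abs_mul,
          abs_of_nonneg (by positivity : 0 ≤ c * a ^ (-(5 : ℝ) / 4))]
        ring_nf
    _ ≤ 1 * 4 * (20 / (1 + ‖x‖) ^ 3 * (2 * |a - 1|)) := by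
        gcongr
        exact hG.trans (by gcongr)
    _ = 160 * |a - 1| / (1 + ‖x‖) ^ 3 := by ring
end

section
/- There exists a constant C > 0 such that for all a₁, a₂ ∈ [1/2, 2] and all x ∈ ℝ³, | (ψ_{a₁}(x) − a₁^{−5/4} ψ₁(x)) − (ψ_{a₂}(x) − a₂^{−5/4} ψ₁(x)) | ≤ C |a₁ − a₂| (1 + ‖x‖)^{−3}, where ψₐ(x) = (3^{1/4}/4) a^{−3/4} (1 − a‖x‖²)(1 + a‖x‖²)^{−3/2}. -/
theorem abs_rpow_neg_sub_rpow_neg_le {m s u v : ℝ} (hm : 0 < m) (hs : 0 ≤ s) (hu : m ≤ u)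
    (hv : m ≤ v) : |u ^ (-s) - v ^ (-s)| ≤ s * m ^ (-s - 1) * |u - v| := by
  have key := (convex_Ici m).norm_image_sub_le_of_norm_hasDerivWithin_le
    (f := fun t : ℝ => t ^ (-s)) (f' := fun t : ℝ => -s * t ^ (-s - 1)) (C := s * m ^ (-s - 1))
    (fun t ht => (Real.hasDerivAt_rpow_const
      (Or.inl (hm.trans_le (Set.mem_Ici.1 ht)).ne')).hasDerivWithinAt)
    (fun t ht => ?_) (Set.mem_Ici.2 hv) (Set.mem_Ici.2 hu)
  · simpa only [Real.norm_eq_abs] using key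
  · have ht' : m ≤ t := ht
    rw [norm_mul, norm_neg, Real.norm_of_nonneg hs,
      Real.norm_of_nonneg (Real.rpow_nonneg (hm.le.trans ht') _)]
    exact mul_le_mul_of_nonneg_left
      (Real.rpow_le_rpow_of_nonpos hm ht' (by linarith)) hs

theorem half_rpow_le {s : ℝ} (n : ℕ) (h : -(n : ℝ) ≤ s) : (1 / 2 : ℝ) ^ s ≤ 2 ^ n := by
  calc (1 / 2 : ℝ) ^ s ≤ (1 / 2 : ℝ) ^ (-(n : ℝ)) :=
        Real.rpow_le_rpow_of_exponent_ge (by norm_num) (by norm_num) h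
    _ = 2 ^ n := by
        rw [Real.rpow_neg (by norm_num), Real.rpow_natCast, one_div, inv_pow, inv_inv]

theorem abs_mul_sub_mul_le {p q p' q' α β γ δ : ℝ} (h₁ : |p - p'| ≤ α) (h₂ : |q| ≤ β)
    (h₃ : |p'| ≤ γ) (h₄ : |q - q'| ≤ δ) : |p * q - p' * q'| ≤ α * β + γ * δ := by
  calc |p * q - p' * q'| = |(p - p') * q + p' * (q - q')| := by congr 1; ring
    _ ≤ |p - p'| * |q| + |p'| * |q - q'| := by
        simpa only [abs_mul] using abs_add_le ((p - p') * q) (p' * (q - q'))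
    _ ≤ α * β + γ * δ :=
        add_le_add (mul_le_mul h₁ h₂ (abs_nonneg _) ((abs_nonneg _).trans h₁))
          (mul_le_mul h₃ h₄ (abs_nonneg _) ((abs_nonneg _).trans h₃))

theorem dsoliton_eq {a : ℝ} (ha : 0 < a) (x : EuclideanSpace ℝ (Fin 3)) :
    dsoliton a x = ((3 : ℝ) ^ ((1 : ℝ) / 4) / 4) *
      (2 * (a ^ (-(9 / 4 : ℝ)) * (‖x‖ ^ 2 + a⁻¹) ^ (-(3 / 2 : ℝ))) -
        a ^ (-(5 / 4 : ℝ)) * (‖x‖ ^ 2 + a⁻¹) ^ (-(1 / 2 : ℝ))) := by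
  have hr : 0 < ‖x‖ ^ 2 + a⁻¹ := by positivity
  have h₁ : 1 + a * ‖x‖ ^ 2 = a * (‖x‖ ^ 2 + a⁻¹) := by field_simp; ring
  have h₂ : 1 - a * ‖x‖ ^ 2 = 2 - a * (‖x‖ ^ 2 + a⁻¹) := by field_simp; ring
  have h₃ : a ^ (-(9 / 4 : ℝ)) = a ^ (-(3 : ℝ) / 4) * a ^ (-(3 : ℝ) / 2) := by
    rw [← Real.rpow_add ha]; norm_num
  have h₄ : a ^ (-(5 / 4 : ℝ)) = a ^ (-(9 / 4 : ℝ)) * a := by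
    rw [← Real.rpow_add_one ha.ne']; norm_num
  have h₅ : (‖x‖ ^ 2 + a⁻¹) ^ (-(1 / 2 : ℝ)) =
      (‖x‖ ^ 2 + a⁻¹) ^ (-(3 / 2 : ℝ)) * (‖x‖ ^ 2 + a⁻¹) := by
    rw [← Real.rpow_add_one hr.ne']; norm_num
  rw [dsoliton, h₂, h₁, Real.mul_rpow ha.le hr.le, h₅, h₄, h₃, neg_div 2 (3 : ℝ)]
  ring

theorem half_one_add_sq_rpow_le {t : ℝ} (ht : 0 ≤ t) :
    ((t ^ 2 + 1) / 2) ^ (-(3 / 2 : ℝ)) ≤ 8 / (1 + t) ^ 3 := by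
  calc ((t ^ 2 + 1) / 2) ^ (-(3 / 2 : ℝ)) ≤ (((1 + t) / 2) ^ 2) ^ (-(3 / 2 : ℝ)) :=
        Real.rpow_le_rpow_of_nonpos (by positivity) (by nlinarith [sq_nonneg (1 - t)])
          (by norm_num)
    _ = (((1 + t) / 2) ^ 3)⁻¹ := by
        rw [← Real.rpow_natCast, ← Real.rpow_mul (by positivity), ← Real.rpow_natCast,
          ← Real.rpow_neg (by positivity)]
        norm_num
    _ = 8 / (1 + t) ^ 3 := by field_simp; norm_num

theorem abs_inv_sub_inv_le {a b : ℝ} (ha : 1 / 2 ≤ a) (hb : 1 / 2 ≤ b) :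
    |a⁻¹ - b⁻¹| ≤ 4 * |a - b| := by
  have h := abs_rpow_neg_sub_rpow_neg_le (s := 1) (by norm_num) zero_le_one ha hb
  simp only [Real.rpow_neg_one] at h
  refine h.trans (mul_le_mul_of_nonneg_right ?_ (abs_nonneg _))
  have := half_rpow_le (s := -1 - 1) 2 (by norm_num)
  linarith

/-- Lipschitz-in-`a` bound used in the contraction argument comparing two modulation paths:
there is `C > 0` such that for all `a₁, a₂ ∈ [1/2, 2]` and all `x ∈ ℝ³`,
`|(ψ_{a₁}(x) − a₁^{−5/4}ψ₁(x)) − (ψ_{a₂}(x) − a₂^{−5/4}ψ₁(x))| ≤ C |a₁ − a₂| (1 + ‖x‖)^{−3}`. -/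
theorem stmt_17 :
    ∃ C : ℝ, 0 < C ∧ ∀ a₁ ∈ Set.Icc (1 / 2 : ℝ) 2, ∀ a₂ ∈ Set.Icc (1 / 2 : ℝ) 2,
      ∀ x : EuclideanSpace ℝ (Fin 3),
        |(dsoliton a₁ x - a₁ ^ (-(5 : ℝ) / 4) * dsoliton 1 x) -
            (dsoliton a₂ x - a₂ ^ (-(5 : ℝ) / 4) * dsoliton 1 x)|
          ≤ C * |a₁ - a₂| / (1 + ‖x‖) ^ 3 := by
  refine ⟨2400, by norm_num, fun a₁ ha₁ a₂ ha₂ x => ?_⟩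
  have hr : 0 ≤ ‖x‖ ^ 2 := by positivity
  have hM8 := half_one_add_sq_rpow_le (norm_nonneg x)
  have hK : (3 : ℝ) ^ ((1 : ℝ) / 4) / 4 ≤ 1 := by
    have : (3 : ℝ) ^ ((1 : ℝ) / 4) ≤ 3 ^ (1 : ℝ) :=
      Real.rpow_le_rpow_of_exponent_le (by norm_num) (by norm_num)
    rw [Real.rpow_one] at this
    linarith
  have hK0 : 0 ≤ (3 : ℝ) ^ ((1 : ℝ) / 4) / 4 := by positivity
  rw [dsoliton_eq (a := a₁) (by linarith [ha₁.1]), dsoliton_eq (a := a₂) (by linarith [ha₂.1]),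
    dsoliton_eq one_pos, neg_div 4 (5 : ℝ)]
  simp only [Real.one_rpow, inv_one, one_mul]
  set K := (3 : ℝ) ^ ((1 : ℝ) / 4) / 4
  set r := ‖x‖ ^ 2
  set m := (r + 1) / 2 with hm
  set M := m ^ (-(3 / 2 : ℝ))
  have hm0 : 0 < m := by positivity
  have hM0 : 0 ≤ M := by positivity
  have hbnd : ∀ a ∈ Set.Icc (1 / 2 : ℝ) 2, 1 / 2 ≤ a⁻¹ ∧ a⁻¹ ≤ 2 := by
    intro a ha
    have h0 : 0 < a := by linarith [ha.1]
    constructor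
    · rw [one_div]; exact inv_anti₀ h0 ha.2
    · rw [inv_le_comm₀ h0 two_pos]; linarith [ha.1]
  obtain ⟨hb₁, hb₁'⟩ := hbnd a₁ ha₁
  obtain ⟨hb₂, hb₂'⟩ := hbnd a₂ ha₂
  have hu₁ : m ≤ r + a₁⁻¹ := by linarith
  have hu₂ : m ≤ r + a₂⁻¹ := by linarith
  have hu₀ : m ≤ r + 1 := by linarith
  have hinv := abs_inv_sub_inv_le ha₁.1 ha₂.1
  have hd0 := abs_nonneg (a₁ - a₂)
  have hdiff : |(r + a₁⁻¹) - (r + a₂⁻¹)| ≤ 4 * |a₁ - a₂| := by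
    rwa [add_sub_add_left_eq_sub]
  have hA : |a₁ ^ (-(5 / 4 : ℝ)) - a₂ ^ (-(5 / 4 : ℝ))| ≤ 10 * |a₁ - a₂| := by
    refine (abs_rpow_neg_sub_rpow_neg_le (by norm_num) (by norm_num) ha₁.1 ha₂.1).trans
      (mul_le_mul_of_nonneg_right ?_ hd0)
    linarith [half_rpow_le (s := -(5 / 4) - 1) 3 (by norm_num)]
  have hB : |a₁ ^ (-(9 / 4 : ℝ)) - a₂ ^ (-(9 / 4 : ℝ))| ≤ 36 * |a₁ - a₂| := by
    refine (abs_rpow_neg_sub_rpow_neg_le (by norm_num) (by norm_num) ha₁.1 ha₂.1).trans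
      (mul_le_mul_of_nonneg_right ?_ hd0)
    linarith [half_rpow_le (s := -(9 / 4) - 1) 4 (by norm_num)]
  have ha₂0 : 0 ≤ a₂ := by linarith [ha₂.1]
  have hA₂ : |a₂ ^ (-(5 / 4 : ℝ))| ≤ 4 := by
    rw [abs_of_nonneg (Real.rpow_nonneg ha₂0 _)]
    refine (Real.rpow_le_rpow_of_nonpos (by norm_num) ha₂.1 (by norm_num)).trans ?_
    linarith [half_rpow_le (s := -(5 / 4)) 2 (by norm_num)]
  have hB₂ : |a₂ ^ (-(9 / 4 : ℝ))| ≤ 8 := by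
    rw [abs_of_nonneg (Real.rpow_nonneg ha₂0 _)]
    refine (Real.rpow_le_rpow_of_nonpos (by norm_num) ha₂.1 (by norm_num)).trans ?_
    linarith [half_rpow_le (s := -(9 / 4)) 3 (by norm_num)]
  have hQ : ∀ u, m ≤ u → |u ^ (-(3 / 2 : ℝ))| ≤ M := fun u hu => by
    rw [abs_of_nonneg (Real.rpow_nonneg (hm0.le.trans hu) _)]
    exact Real.rpow_le_rpow_of_nonpos hm0 hu (by norm_num)
  have hP : ∀ u v, m ≤ u → m ≤ v →
      |u ^ (-(1 / 2 : ℝ)) - v ^ (-(1 / 2 : ℝ))| ≤ 1 / 2 * M * |u - v| := fun u v hu hv => by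
    have h := abs_rpow_neg_sub_rpow_neg_le (s := 1 / 2) hm0 (by norm_num) hu hv
    rwa [show (-(1 / 2) - 1 : ℝ) = -(3 / 2) by norm_num] at h
  have hP₁ : |(r + a₁⁻¹) ^ (-(1 / 2 : ℝ)) - (r + 1) ^ (-(1 / 2 : ℝ))| ≤ 1 / 2 * M := by
    refine (hP _ _ hu₁ hu₀).trans (mul_le_of_le_one_right (by positivity) ?_)
    rw [abs_le]; constructor <;> linarith
  have hP₁₂ : |((r + a₁⁻¹) ^ (-(1 / 2 : ℝ)) - (r + 1) ^ (-(1 / 2 : ℝ))) -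
      ((r + a₂⁻¹) ^ (-(1 / 2 : ℝ)) - (r + 1) ^ (-(1 / 2 : ℝ)))| ≤
      1 / 2 * M * (4 * |a₁ - a₂|) := by
    rw [sub_sub_sub_cancel_right]
    exact (hP _ _ hu₁ hu₂).trans (mul_le_mul_of_nonneg_left hdiff (by positivity))
  have hQ₁₂ : |(r + a₁⁻¹) ^ (-(3 / 2 : ℝ)) - (r + a₂⁻¹) ^ (-(3 / 2 : ℝ))| ≤
      3 * M * (4 * |a₁ - a₂|) := by
    refine (abs_rpow_neg_sub_rpow_neg_le hm0 (by norm_num) hu₁ hu₂).trans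
      (mul_le_mul ?_ hdiff (abs_nonneg _) (by positivity))
    have hm2 : m⁻¹ ≤ 2 := by
      rw [inv_le_comm₀ hm0 two_pos]; linarith
    have hM2 : m ^ (-(3 / 2 : ℝ) - 1) ≤ M * 2 := by
      rw [Real.rpow_sub_one hm0.ne', div_eq_mul_inv (m ^ _)]
      exact mul_le_mul_of_nonneg_left hm2 hM0
    linarith
  have e₁ := abs_mul_sub_mul_le hA hP₁ hA₂ hP₁₂
  have e₂ := abs_mul_sub_mul_le hB (hQ _ hu₁) hB₂ hQ₁₂
  have e₃ : |(a₁ ^ (-(5 / 4 : ℝ)) - a₂ ^ (-(5 / 4 : ℝ))) * (r + 1) ^ (-(3 / 2 : ℝ))| ≤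
      10 * |a₁ - a₂| * M := by
    rw [abs_mul]
    exact mul_le_mul hA (hQ _ hu₀) (abs_nonneg _) (by positivity)
  generalize a₁ ^ (-(5 / 4 : ℝ)) = A₁ at *
  generalize a₂ ^ (-(5 / 4 : ℝ)) = A₂ at *
  generalize a₁ ^ (-(9 / 4 : ℝ)) = B₁ at *
  generalize a₂ ^ (-(9 / 4 : ℝ)) = B₂ at *
  generalize (r + a₁⁻¹) ^ (-(1 / 2 : ℝ)) = P₁ at *
  generalize (r + a₂⁻¹) ^ (-(1 / 2 : ℝ)) = P₂ at *
  generalize (r + 1) ^ (-(1 / 2 : ℝ)) = P₀ at *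
  generalize (r + a₁⁻¹) ^ (-(3 / 2 : ℝ)) = Q₁ at *
  generalize (r + a₂⁻¹) ^ (-(3 / 2 : ℝ)) = Q₂ at *
  generalize (r + 1) ^ (-(3 / 2 : ℝ)) = Q₀ at *
  have hMd : 0 ≤ M * |a₁ - a₂| := by positivity
  have hsum : |2 * (B₁ * Q₁ - B₂ * Q₂) - (A₁ * (P₁ - P₀) - A₂ * (P₂ - P₀)) -
      2 * ((A₁ - A₂) * Q₀)| ≤ 300 * (M * |a₁ - a₂|) := by
    rw [abs_le] at e₁ e₂ e₃ ⊢
    constructor <;> linarith [e₁.1, e₁.2, e₂.1, e₂.2, e₃.1, e₃.2]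
  calc _ = |K * (2 * (B₁ * Q₁ - B₂ * Q₂) - (A₁ * (P₁ - P₀) - A₂ * (P₂ - P₀)) -
      2 * ((A₁ - A₂) * Q₀))| := by congr 1; ring
    _ ≤ 1 * (300 * (M * |a₁ - a₂|)) := by
        rw [abs_mul, abs_of_nonneg hK0]
        exact mul_le_mul hK hsum (abs_nonneg _) zero_le_one
    _ ≤ 1 * (300 * (8 / (1 + ‖x‖) ^ 3 * |a₁ - a₂|)) := by gcongr
    _ = 2400 * |a₁ - a₂| / (1 + ‖x‖) ^ 3 := by ring
end
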